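/- arXiv:1409.5424 — 3 statements merged into one kernel-verified Lean document; each statement's English description precedes it below -/
import Mathlib

section
/- (Schmüdgen's Corollary) Let f₁,…,f_{n₁}, h₁,…,h_{n₃} ∈ ℝ[x₁,…,xₙ] and suppose the set S = {x ∈ ℝⁿ : fᵢ(x) ≥ 0 for i = 1,…,n₁ and hⱼ(x) = 0 for j = 1,…,n₃} is compact. If p ∈ ℝ[x₁,…,xₙ] satisfies p(x) > 0 for all x ∈ S, then there exist SOS polynomials s_k for each k ∈ {0,1}^{n₁} and polynomials q₁,…,q_{n₃} ∈ ℝ[x₁,…,xₙ] such that p = Σ_{k ∈ {0,1}^{n₁}} s_k · Πᵢ fᵢ^{kᵢ} + Σⱼ qⱼ hⱼ. -/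
open MvPolynomial

/-- A polynomial is a sum of squares if it is a finite sum of squares of polynomials. -/
def IsSOS {σ : Type*} (p : MvPolynomial σ ℝ) : Prop :=
  ∃ (m : ℕ) (f : Fin m → MvPolynomial σ ℝ), p = ∑ i, f i ^ 2

namespace RingPreordering

variable {R : Type*} [CommRing R]

/-- The preordering `Q + aQ` obtained by adjoining an element. -/
def adjoin (Q : RingPreordering R) (a : R) (h : ∀ x ∈ Q, ∀ y ∈ Q, x + a * y ≠ -1) :
    RingPreordering R :=
  .mk' {z | ∃ x ∈ Q, ∃ y ∈ Q, x + a * y = z}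
    (by
      rintro _ _ ⟨x, hx, y, hy, rfl⟩ ⟨z, hz, w, hw, rfl⟩
      exact ⟨x + z, add_mem hx hz, y + w, add_mem hy hw, by ring⟩)
    (by
      rintro _ _ ⟨x, hx, y, hy, rfl⟩ ⟨z, hz, w, hw, rfl⟩
      exact ⟨x * z + (a * a) * (y * w),
        add_mem (mul_mem hx hz) (mul_mem (Q.mem_of_isSquare' ⟨a, rfl⟩) (mul_mem hy hw)),
        x * w + y * z, add_mem (mul_mem hx hw) (mul_mem hy hz), by ring⟩)
    (fun x ↦ ⟨x * x, Q.mem_of_isSquare' ⟨x, rfl⟩, 0, zero_mem Q, by ring⟩)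
    (by
      rintro ⟨x, hx, y, hy, h'⟩
      exact h x hx y hy h')

theorem exists_add_mul_eq_neg_one {Q : RingPreordering R} (hQ : IsMax Q) {a : R} (ha : a ∉ Q) :
    ∃ x ∈ Q, ∃ y ∈ Q, x + a * y = -1 := by
  by_contra! h
  refine ha (hQ (b := Q.adjoin a h) (fun x hx ↦ ⟨x, hx, 0, zero_mem Q, by ring⟩)
    ⟨0, zero_mem Q, 1, one_mem Q, by ring⟩)

theorem exists_le_isMax (P : RingPreordering R) : ∃ Q, P ≤ Q ∧ IsMax Q := by
  refine zorn_le_nonempty_Ici₀ P (fun c _ hc y hy ↦ ?_) P le_rfl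
  refine ⟨.mk' (⋃ Q ∈ c, (Q : Set R)) ?_ ?_ ?_ ?_, fun Q hQ x hx ↦ ?_⟩
  · intro a b ha hb
    simp only [Set.mem_iUnion, SetLike.mem_coe, exists_prop] at ha hb ⊢
    obtain ⟨A, hA, ha⟩ := ha
    obtain ⟨B, hB, hb⟩ := hb
    rcases hc.total hA hB with h | h
    · exact ⟨B, hB, add_mem (h ha) hb⟩
    · exact ⟨A, hA, add_mem ha (h hb)⟩
  · intro a b ha hb
    simp only [Set.mem_iUnion, SetLike.mem_coe, exists_prop] at ha hb ⊢
    obtain ⟨A, hA, ha⟩ := ha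
    obtain ⟨B, hB, hb⟩ := hb
    rcases hc.total hA hB with h | h
    · exact ⟨B, hB, mul_mem (h ha) hb⟩
    · exact ⟨A, hA, mul_mem ha (h hb)⟩
  · intro x
    simp only [Set.mem_iUnion, SetLike.mem_coe, exists_prop]
    exact ⟨y, hy, y.mem_of_isSquare' ⟨x, rfl⟩⟩
  · simp only [Set.mem_iUnion, SetLike.mem_coe, exists_prop, not_exists, not_and]
    exact fun Q _ ↦ Q.neg_one_notMem'
  · show x ∈ ⋃ Q ∈ c, (Q : Set R)
    simp only [Set.mem_iUnion, SetLike.mem_coe, exists_prop]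
    exact ⟨Q, hQ, hx⟩

/-- Every preordering is contained in an ordering. -/
theorem exists_le_isOrdering (P : RingPreordering R) : ∃ Q, P ≤ Q ∧ Q.IsOrdering := by
  obtain ⟨Q, hPQ, hQ⟩ := P.exists_le_isMax
  have hmem : HasMemOrNegMem Q := by
    refine ⟨fun a ↦ ?_⟩
    by_contra! h
    obtain ⟨x, hx, y, hy, h1⟩ := exists_add_mul_eq_neg_one hQ h.1
    obtain ⟨z, hz, w, hw, h2⟩ := exists_add_mul_eq_neg_one hQ h.2
    refine Q.neg_one_notMem' (?_ : (-1 : R) ∈ Q)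
    have : (-1 : R) = x + z + x * z + a * a * (y * w) := by
      linear_combination (-1 - z) * h1 + a * y * h2
    rw [this]
    exact add_mem (add_mem (add_mem hx hz) (mul_mem hx hz))
      (mul_mem (Q.mem_of_isSquare' ⟨a, rfl⟩) (mul_mem hy hw))
  have key (a b : R) (ha : a ∉ Q) (hb : b ∉ Q) : -(a * b) ∉ Q := by
    intro hab
    obtain ⟨x, hx, y, hy, h1⟩ := exists_add_mul_eq_neg_one hQ ha
    obtain ⟨z, hz, w, hw, h2⟩ := exists_add_mul_eq_neg_one hQ hb
    refine Q.neg_one_notMem' (?_ : (-1 : R) ∈ Q)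
    have : (-1 : R) = x + z + x * z + -(a * b) * (y * w) := by
      linear_combination (-1 - z) * h1 + a * y * h2
    rw [this]
    exact add_mem (add_mem (add_mem hx hz) (mul_mem hx hz)) (mul_mem hab (mul_mem hy hw))
  refine ⟨Q, hPQ, .mk' Q fun {a b} hab ↦ ?_⟩
  by_contra! h
  simp only [mem_support, not_and_or] at h hab
  rcases h with ⟨ha | ha, hb | hb⟩
  · exact key a b ha hb hab.2
  · exact key a (-b) ha hb (by simpa using hab.1)
  · exact key (-a) b ha hb (by simpa using hab.1)
  · exact key (-a) (-b) ha hb (by simpa using hab.2)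

/-- An ordering of a field is the positive cone of a linear order. -/
theorem exists_linearOrder {L : Type*} [Field L] (Q : RingPreordering L) [Q.IsOrdering] :
    ∃ (_ : LinearOrder L) (_ : IsStrictOrderedRing L), ∀ x : L, 0 ≤ x ↔ x ∈ Q := by
  classical
  let C : RingCone L :=
    { Q.toSubsemiring with
      eq_zero_of_mem_of_neg_mem' := by
        intro a ha hna
        have : a ∈ Q.support := ⟨ha, hna⟩
        by_contra h0
        exact (inferInstance : Q.support.IsPrime).ne_top (Ideal.eq_top_of_isUnit_mem _ this (IsUnit.mk0 _ h0)) }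
  have hC : HasMemOrNegMem C := ⟨fun a ↦ mem_or_neg_mem Q a⟩
  let _ : DecidablePred (· ∈ C) := Classical.decPred _
  let o : LinearOrder L := LinearOrder.mkOfAddGroupCone C
  have : IsOrderedRing L := .mkOfCone C
  refine ⟨o, inferInstance, fun x ↦ ?_⟩
  show x - 0 ∈ Q ↔ _
  rw [sub_zero]

end RingPreordering

section

open Polynomial

/-- The intermediate value property for polynomials over an ordered field. -/
def PolynomialIVT (K : Type*) [Field K] [LinearOrder K] : Prop :=
  ∀ (p : K[X]) (a b : K), a < b → p.eval a < 0 → 0 < p.eval b → ∃ c, a < c ∧ c < b ∧ p.eval c = 0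

section SignChange

variable {L : Type*} [Field L] [LinearOrder L]

/-- The cone of polynomials generated by squares and nonnegative constants. -/
noncomputable def squareCone (L : Type*) [Field L] [LinearOrder L] : AddSubmonoid L[X] :=
  AddSubmonoid.closure {q | ∃ c g, 0 ≤ c ∧ q = Polynomial.C c * g ^ 2}

theorem exists_squareCone_natDegree_le {f σ : L[X]} (hf : f.natDegree ≠ 0)
    (hσ : σ ∈ squareCone L) :
    ∃ τ ∈ squareCone L, f ∣ σ - τ ∧ τ.natDegree + 2 ≤ 2 * f.natDegree := by
  induction hσ using AddSubmonoid.closure_induction with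
  | mem x hx =>
    obtain ⟨c, g, hc, rfl⟩ := hx
    refine ⟨Polynomial.C c * (g % f) ^ 2, AddSubmonoid.subset_closure ⟨c, _, hc, rfl⟩,
      ⟨Polynomial.C c * (g / f) * (g + g % f), ?_⟩, ?_⟩
    · have := EuclideanDomain.div_add_mod g f
      linear_combination Polynomial.C c * (g + g % f) * (-this)
    · have h1 := natDegree_mod_lt g hf
      have h2 := natDegree_C_mul_le c ((g % f) ^ 2)
      have h3 := natDegree_pow_le (p := g % f) (n := 2)
      omega
  | zero => exact ⟨0, zero_mem _, by simp, by simp; omega⟩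
  | add x y _ _ hx hy =>
    obtain ⟨τ, hτ, h1, h2⟩ := hx
    obtain ⟨τ', hτ', h1', h2'⟩ := hy
    refine ⟨τ + τ', add_mem hτ hτ', ?_, ?_⟩
    · convert dvd_add h1 h1' using 1
      ring
    · have := natDegree_add_le τ τ'
      omega

variable [IsStrictOrderedRing L]

theorem eval_nonneg_of_mem_squareCone {σ : L[X]} (hσ : σ ∈ squareCone L) (a : L) :
    0 ≤ σ.eval a := by
  induction hσ using AddSubmonoid.closure_induction with
  | mem x hx =>
    obtain ⟨c, g, hc, rfl⟩ := hx
    simp only [Polynomial.eval_mul, Polynomial.eval_C, Polynomial.eval_pow]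
    positivity
  | zero => simp
  | add x y _ _ hx hy =>
    rw [Polynomial.eval_add]
    positivity

/-- A polynomial which changes sign does not divide `1 + σ` for a sum of squares `σ`. -/
theorem not_dvd_one_add_of_eval_mul_eval_neg (n : ℕ) : ∀ (f σ : L[X]) (a b : L),
    f.natDegree = n → f.eval a * f.eval b < 0 → σ ∈ squareCone L → ¬ f ∣ 1 + σ := by
  induction n using Nat.strong_induction_on with
  | _ n ih =>
    rintro f σ a b rfl hab hσ hdvd
    have hf : f.natDegree ≠ 0 := by
      intro h0
      rw [eq_C_of_natDegree_eq_zero h0] at hab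
      simp only [Polynomial.eval_C] at hab
      nlinarith
    obtain ⟨τ, hτ, h1, h2⟩ := exists_squareCone_natDegree_le hf hσ
    obtain ⟨h, hh⟩ : f ∣ 1 + τ := by
      convert dvd_sub hdvd h1 using 1
      ring
    have ha := congrArg (Polynomial.eval a) hh
    have hb := congrArg (Polynomial.eval b) hh
    simp only [Polynomial.eval_add, eval_one, Polynomial.eval_mul] at ha hb
    have ha' := eval_nonneg_of_mem_squareCone hτ a
    have hb' := eval_nonneg_of_mem_squareCone hτ b
    have hab' : h.eval a * h.eval b < 0 := by
      by_contra! hcon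
      nlinarith [mul_nonneg hcon (neg_nonneg.2 hab.le)]
    have hh0 : h ≠ 0 := by
      rintro rfl
      simp at hab'
    have hf0 : f ≠ 0 := by
      rintro rfl
      simp at hf
    have hdeg := natDegree_mul hf0 hh0
    rw [← hh] at hdeg
    have hle : (1 + τ).natDegree ≤ max 0 τ.natDegree := by
      simpa using natDegree_add_le (1 : L[X]) τ
    exact ih h.natDegree (by omega) h τ a b rfl hab' hτ ⟨f, by rw [hh, mul_comm]⟩

theorem exists_irreducible_eval_mul_eval_neg {p : L[X]} {a b : L}
    (hp : p.eval a * p.eval b < 0) : ∃ f, Irreducible f ∧ f ∣ p ∧ f.eval a * f.eval b < 0 := by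
  induction p using WfDvdMonoid.induction_on_irreducible with
  | zero => simp at hp
  | unit u hu =>
    obtain ⟨c, hc, rfl⟩ := Polynomial.isUnit_iff.1 hu
    simp only [Polynomial.eval_C] at hp
    nlinarith
  | mul q f hq hf ih =>
    by_cases h : f.eval a * f.eval b < 0
    · exact ⟨f, hf, dvd_mul_right _ _, h⟩
    · have : q.eval a * q.eval b < 0 := by
        by_contra! hcon
        simp only [Polynomial.eval_mul] at hp
        nlinarith [mul_nonneg (not_lt.1 h) hcon]
      obtain ⟨g, hg, hgq, hgs⟩ := ih this
      exact ⟨g, hg, hgq.mul_left _, hgs⟩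

theorem root_mem_of_irreducible_of_eval_mul_eval_neg {f : L[X]} (hf : Irreducible f) {a b r : L}
    (hab : a < b) (hfab : f.eval a * f.eval b < 0) (hr : f.IsRoot r) : a < r ∧ r < b := by
  have hdeg := degree_eq_one_of_irreducible_of_root hf hr
  obtain ⟨g, rfl⟩ := dvd_iff_isRoot.2 hr
  have hg : g.natDegree = 0 := by
    have h0 : g ≠ 0 := right_ne_zero_of_mul hf.ne_zero
    have h1 : _ = 1 := natDegree_eq_of_degree_eq_some hdeg
    rw [natDegree_mul (X_sub_C_ne_zero r) h0, natDegree_X_sub_C] at h1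
    omega
  rw [eq_C_of_natDegree_eq_zero hg] at hfab
  simp only [Polynomial.eval_mul, Polynomial.eval_sub, Polynomial.eval_X, Polynomial.eval_C] at hfab
  have hlt : (a - r) * (b - r) < 0 := by
    by_contra! hcon
    nlinarith [mul_nonneg hcon (mul_self_nonneg (g.coeff 0))]
  constructor <;> by_contra! <;> nlinarith

end SignChange

section RealClosure

variable {F Ω : Type*} [Field F] [Field Ω] [Algebra F Ω]

/-- The cone generated by `T` and the squares of `L`, inside an ambient field. -/
def relativeCone (T : RingPreordering F) (L : IntermediateField F Ω) : AddSubmonoid Ω :=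
  AddSubmonoid.closure {z | ∃ t ∈ T, ∃ l ∈ L, z = algebraMap F Ω t * l ^ 2}

theorem relativeCone_mono (T : RingPreordering F) {L L' : IntermediateField F Ω} (h : L ≤ L') :
    relativeCone T L ≤ relativeCone T L' :=
  AddSubmonoid.closure_mono fun _ ⟨t, ht, l, hl, e⟩ ↦ ⟨t, ht, l, h hl, e⟩

theorem mul_mem_relativeCone (T : RingPreordering F) (L : IntermediateField F Ω) {z w : Ω}
    (hz : z ∈ relativeCone T L) (hw : w ∈ relativeCone T L) : z * w ∈ relativeCone T L := by
  induction hz, hw using AddSubmonoid.closure_induction₂ with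
  | mem x y hx hy =>
    obtain ⟨t, ht, l, hl, rfl⟩ := hx
    obtain ⟨t', ht', l', hl', rfl⟩ := hy
    refine AddSubmonoid.subset_closure ⟨t * t', mul_mem ht ht', l * l', mul_mem hl hl', ?_⟩
    rw [map_mul]
    ring
  | zero_left x _ => simp
  | zero_right x _ => simp
  | add_left x y z _ _ _ hx hy => rw [add_mul]; exact add_mem hx hy
  | add_right x y z _ _ _ hx hy => rw [mul_add]; exact add_mem hx hy

theorem neg_one_notMem_relativeCone_bot (T : RingPreordering F) :
    (-1 : Ω) ∉ relativeCone T (⊥ : IntermediateField F Ω) := by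
  have key {z : Ω} (hz : z ∈ relativeCone T (⊥ : IntermediateField F Ω)) :
      ∃ t ∈ T, algebraMap F Ω t = z := by
    induction hz using AddSubmonoid.closure_induction with
    | mem x hx =>
      obtain ⟨t, ht, l, hl, rfl⟩ := hx
      obtain ⟨l, rfl⟩ := IntermediateField.mem_bot.1 hl
      exact ⟨t * (l * l), mul_mem ht (T.mem_of_isSquare' ⟨l, rfl⟩), by simp [sq]⟩
    | zero => exact ⟨0, zero_mem T, map_zero _⟩
    | add x y _ _ hx hy =>
      obtain ⟨t, ht, rfl⟩ := hx
      obtain ⟨t', ht', rfl⟩ := hy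
      exact ⟨t + t', add_mem ht ht', map_add _ _ _⟩
  intro h
  obtain ⟨t, ht, e⟩ := key h
  have : t = -1 := (algebraMap F Ω).injective (by simpa using e)
  exact T.neg_one_notMem' (this ▸ ht)

theorem exists_maximal_relativeCone (T : RingPreordering F) :
    ∃ L : IntermediateField F Ω, Maximal (fun L ↦ (-1 : Ω) ∉ relativeCone T L) L := by
  suffices h : ∀ c ⊆ {L : IntermediateField F Ω | (-1 : Ω) ∉ relativeCone T L},
      IsChain (· ≤ ·) c → ∀ y ∈ c, ∃ ub ∈ {L : IntermediateField F Ω | (-1 : Ω) ∉ relativeCone T L},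
        ∀ z ∈ c, z ≤ ub from
    (zorn_le_nonempty₀ _ h ⊥ (neg_one_notMem_relativeCone_bot T)).imp fun _ hm ↦ hm.2
  intro c hcs hc y hy
  refine ⟨sSup c, ?_, fun L hL ↦ le_sSup hL⟩
  have hmem {z : Ω} (hz : z ∈ sSup c) : ∃ L ∈ c, z ∈ L := by
    rw [sSup_eq_iSup'] at hz
    have : Nonempty c := ⟨⟨y, hy⟩⟩
    have hdir : Directed (· ≤ ·) (fun L : c ↦ (L : IntermediateField F Ω)) :=
      hc.directedOn.directed_val
    have := (IntermediateField.coe_iSup_of_directed hdir)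
    have h' : z ∈ ((⨆ L : c, (L : IntermediateField F Ω) : IntermediateField F Ω) : Set Ω) := hz
    rw [this, Set.mem_iUnion] at h'
    obtain ⟨L, hL⟩ := h'
    exact ⟨L, L.2, hL⟩
  have key {z : Ω} (hz : z ∈ relativeCone T (sSup c)) : ∃ L ∈ c, z ∈ relativeCone T L := by
    induction hz using AddSubmonoid.closure_induction with
    | mem x hx =>
      obtain ⟨t, ht, l, hl, rfl⟩ := hx
      obtain ⟨L, hL, hlL⟩ := hmem hl
      exact ⟨L, hL, AddSubmonoid.subset_closure ⟨t, ht, l, hlL, rfl⟩⟩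
    | zero => exact ⟨y, hy, zero_mem _⟩
    | add x y _ _ hx hy =>
      obtain ⟨A, hA, ha⟩ := hx
      obtain ⟨B, hB, hb⟩ := hy
      rcases hc.total hA hB with h | h
      · exact ⟨B, hB, add_mem (relativeCone_mono T h ha) hb⟩
      · exact ⟨A, hA, add_mem ha (relativeCone_mono T h hb)⟩
  intro h
  obtain ⟨L, hL, hL'⟩ := key h
  exact hcs hL hL'

theorem exists_squareCone_of_mem_relativeCone [Algebra.IsAlgebraic F Ω] {T : RingPreordering F}
    {L : IntermediateField F Ω} [LinearOrder L] [IsStrictOrderedRing L]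
    (hT : ∀ t ∈ T, 0 ≤ algebraMap F L t) {α z : Ω}
    (hz : z ∈ relativeCone T ((IntermediateField.adjoin L {α}).restrictScalars F)) :
    ∃ σ ∈ squareCone L, Polynomial.aeval α σ = z := by
  induction hz using AddSubmonoid.closure_induction with
  | mem x hx =>
    obtain ⟨t, ht, l, hl, rfl⟩ := hx
    rw [IntermediateField.mem_restrictScalars] at hl
    have hα : IsIntegral L α := (Algebra.IsIntegral.isIntegral (R := F) α).tower_top
    rw [← IntermediateField.mem_toSubalgebra,
      IntermediateField.adjoin_simple_toSubalgebra_of_isAlgebraic hα.isAlgebraic] at hl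
    obtain ⟨g, rfl⟩ := Algebra.adjoin_mem_exists_aeval L α hl
    refine ⟨Polynomial.C (algebraMap F L t) * g ^ 2, AddSubmonoid.subset_closure ⟨_, g, hT t ht, rfl⟩, ?_⟩
    rw [map_mul, map_pow, Polynomial.aeval_C, ← IsScalarTower.algebraMap_apply]
  | zero => exact ⟨0, zero_mem _, map_zero _⟩
  | add x y _ _ hx hy =>
    obtain ⟨t, ht, rfl⟩ := hx
    obtain ⟨t', ht', rfl⟩ := hy
    exact ⟨t + t', add_mem ht ht', map_add _ _ _⟩

theorem exists_polynomialIVT_extension.{u} {F : Type u} [Field F] (T : RingPreordering F) :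
    ∃ (K : Type u) (_ : Field K) (_ : LinearOrder K) (_ : IsStrictOrderedRing K) (φ : F →+* K),
      PolynomialIVT K ∧ ∀ t ∈ T, 0 ≤ φ t := by
  obtain ⟨L, hL⟩ := exists_maximal_relativeCone (Ω := AlgebraicClosure F) T
  let P : RingPreordering L := .mk' {x | (x : AlgebraicClosure F) ∈ relativeCone T L}
    (fun hx hy ↦ by exact AddSubmonoid.add_mem (relativeCone T L) hx hy)
    (fun hx hy ↦ mul_mem_relativeCone T L hx hy)
    (fun x ↦ AddSubmonoid.subset_closure ⟨1, one_mem T, x, x.2, by simp [sq]⟩)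
    (by simpa using hL.1)
  obtain ⟨Q, hPQ, hQ⟩ := P.exists_le_isOrdering
  obtain ⟨o, ho, hoQ⟩ := Q.exists_linearOrder
  have hT (t : F) (ht : t ∈ T) : 0 ≤ algebraMap F L t := by
    rw [hoQ]
    exact hPQ (AddSubmonoid.subset_closure ⟨t, ht, 1, one_mem L, by simp⟩)
  refine ⟨L, inferInstance, o, ho, algebraMap F L, fun p a b hab ha hb ↦ ?_, hT⟩
  obtain ⟨f, hf, hfp, hfab⟩ :=
    exists_irreducible_eval_mul_eval_neg (mul_neg_of_neg_of_pos ha hb)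
  obtain ⟨α, hα⟩ := IsAlgClosed.exists_aeval_eq_zero (AlgebraicClosure F) f
    (degree_pos_of_irreducible hf).ne'
  have hαL : α ∈ L := by
    by_contra hαL
    have hle : L ≤ (IntermediateField.adjoin L {α}).restrictScalars F := by
      intro x hx
      rw [IntermediateField.mem_restrictScalars]
      exact (IntermediateField.adjoin L {α}).algebraMap_mem ⟨x, hx⟩
    have hmem : α ∈ (IntermediateField.adjoin L {α}).restrictScalars F := by
      rw [IntermediateField.mem_restrictScalars]
      exact IntermediateField.mem_adjoin_simple_self L α
    have hneg : (-1 : AlgebraicClosure F) ∈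
        relativeCone T ((IntermediateField.adjoin L {α}).restrictScalars F) := by
      by_contra hneg
      exact hαL (hL.2 hneg hle hmem)
    obtain ⟨σ, hσ, hσα⟩ := exists_squareCone_of_mem_relativeCone hT hneg
    refine not_dvd_one_add_of_eval_mul_eval_neg _ f σ a b rfl hfab hσ ?_
    by_contra hdvd
    obtain ⟨u, v, huv⟩ := (hf.coprime_iff_not_dvd.2 hdvd)
    have := congrArg (Polynomial.aeval α) huv
    simp [hα, hσα] at this
  have hroot : f.IsRoot ⟨α, hαL⟩ := by
    apply (algebraMap L (AlgebraicClosure F)).injective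
    rw [map_zero, ← hα, ← eval₂_at_apply, Polynomial.aeval_def]
    rfl
  obtain ⟨h1, h2⟩ := root_mem_of_irreducible_of_eval_mul_eval_neg hf hab hfab hroot
  exact ⟨_, h1, h2, (hroot.dvd hfp).eq_zero⟩

end RealClosure

section AsymptoticSign

variable {K : Type*} [Field K] [LinearOrder K] [IsStrictOrderedRing K]

theorem exists_forall_gt_le_eval_of_leadingCoeff_pos (n : ℕ) : ∀ p : K[X], p.natDegree = n →
    0 < p.leadingCoeff → ∃ M ε : K, 0 < ε ∧ ∀ x > M, ε ≤ p.eval x := by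
  induction n with
  | zero =>
    intro p hp hlc
    refine ⟨0, p.leadingCoeff, hlc, fun x _ ↦ ?_⟩
    rw [leadingCoeff, hp]
    conv_rhs => rw [eq_C_of_natDegree_eq_zero hp]
    simp
  | succ n ih =>
    intro p hp hlc
    have hdeg : p.divX.natDegree = n := by rw [natDegree_divX_eq_natDegree_tsub_one]; omega
    obtain ⟨M, ε, hε, hM⟩ := ih p.divX hdeg (by
      rwa [leadingCoeff, hdeg, coeff_divX, ← hp])
    refine ⟨max M (max 0 ((1 - p.coeff 0) / ε)), 1, one_pos, fun x hx ↦ ?_⟩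
    simp only [gt_iff_lt, max_lt_iff] at hx
    obtain ⟨h1, h2, h3⟩ := hx
    rw [div_lt_iff₀ hε] at h3
    have := mul_le_mul_of_nonneg_left (hM x h1) h2.le
    rw [← divX_mul_X_add p]
    simp only [Polynomial.eval_add, Polynomial.eval_mul, Polynomial.eval_X, Polynomial.eval_C]
    linarith

theorem exists_gt_eval_pos_of_derivative_pos {p : K[X]} (hp : p.natDegree ≠ 0) {z : K}
    (h : ∀ x > z, 0 < p.derivative.eval x) : ∃ x > z, 0 < p.eval x := by
  have hp0 : p ≠ 0 := by
    rintro rfl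
    simp at hp
  have hnat : (0 : K) < p.natDegree := by exact_mod_cast Nat.pos_of_ne_zero hp
  rcases lt_or_gt_of_ne (leadingCoeff_ne_zero.2 hp0) with hneg | hpos
  · exfalso
    obtain ⟨M, ε, hε, hM⟩ := exists_forall_gt_le_eval_of_leadingCoeff_pos _ (-p.derivative) rfl
      (by rw [leadingCoeff_neg, leadingCoeff_derivative]; nlinarith)
    obtain ⟨x, hx⟩ := exists_gt (max M z)
    have h1 := hM x ((le_max_left _ _).trans_lt hx)
    have h2 := h x ((le_max_right _ _).trans_lt hx)
    rw [Polynomial.eval_neg] at h1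
    linarith
  · obtain ⟨M, ε, hε, hM⟩ := exists_forall_gt_le_eval_of_leadingCoeff_pos _ p rfl hpos
    obtain ⟨x, hx⟩ := exists_gt (max M z)
    exact ⟨x, (le_max_right _ _).trans_lt hx, hε.trans_le (hM x ((le_max_left _ _).trans_lt hx))⟩

end AsymptoticSign

namespace PolynomialIVT

variable {K : Type*} [Field K] [LinearOrder K] [IsStrictOrderedRing K]

theorem exists_root (hK : PolynomialIVT K) {p : K[X]} {a b : K} (hab : a < b) (h : p.eval a * p.eval b < 0) :
    ∃ c, a < c ∧ c < b ∧ p.eval c = 0 := by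
  rcases mul_neg_iff.1 h with ⟨h1, h2⟩ | ⟨h1, h2⟩
  · simpa using hK (-p) a b hab (by simpa using h1) (by simpa using h2)
  · exact hK p a b hab h1 h2

theorem exists_root_uIcc (hK : PolynomialIVT K) {p : K[X]} {a b : K}
    (h : SignType.sign (p.eval a) ≠ SignType.sign (p.eval b)) :
    ∃ c ∈ Set.uIcc a b, p.eval c = 0 := by
  by_cases ha : p.eval a = 0
  · exact ⟨a, Set.left_mem_uIcc, ha⟩
  by_cases hb : p.eval b = 0
  · exact ⟨b, Set.right_mem_uIcc, hb⟩
  have hneg : p.eval a * p.eval b < 0 := by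
    rcases lt_or_gt_of_ne ha with ha | ha <;> rcases lt_or_gt_of_ne hb with hb | hb
    · simp [sign_neg ha, sign_neg hb] at h
    · exact mul_neg_of_neg_of_pos ha hb
    · exact mul_neg_of_pos_of_neg ha hb
    · simp [sign_pos ha, sign_pos hb] at h
  rcases lt_trichotomy a b with hab | rfl | hab
  · obtain ⟨c, h1, h2, h3⟩ := hK.exists_root hab hneg
    exact ⟨c, Set.mem_uIcc.2 (.inl ⟨h1.le, h2.le⟩), h3⟩
  · exact absurd rfl h
  · obtain ⟨c, h1, h2, h3⟩ := hK.exists_root hab (by rwa [mul_comm])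
    exact ⟨c, Set.mem_uIcc.2 (.inr ⟨h1.le, h2.le⟩), h3⟩

theorem rolle_of_consecutive (hK : PolynomialIVT K) {p : K[X]} (hp : p ≠ 0) {a b : K} (hab : a < b) (ha : p.eval a = 0)
    (hb : p.eval b = 0) (h : ∀ c, a < c → c < b → p.eval c ≠ 0) :
    ∃ c, a < c ∧ c < b ∧ p.derivative.eval c = 0 := by
  obtain ⟨q₁, hq₁, hq₁a⟩ := exists_eq_pow_rootMultiplicity_mul_and_not_dvd p hp a
  obtain ⟨m, hm⟩ := Nat.exists_eq_succ_of_ne_zero ((rootMultiplicity_pos hp).2 ha).ne'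
  rw [hm] at hq₁
  have hq₁0 : q₁ ≠ 0 := by
    rintro rfl
    simp at hq₁a
  have hq₁b : q₁.eval b = 0 := by
    rw [hq₁] at hb
    simpa [sub_ne_zero.2 hab.ne'] using hb
  obtain ⟨q, hq, hqb⟩ := exists_eq_pow_rootMultiplicity_mul_and_not_dvd q₁ hq₁0 b
  obtain ⟨n, hn⟩ := Nat.exists_eq_succ_of_ne_zero ((rootMultiplicity_pos hq₁0).2 hq₁b).ne'
  rw [hn] at hq
  rw [dvd_iff_isRoot, IsRoot.def] at hq₁a hqb
  have hqa : q.eval a ≠ 0 := by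
    intro h0
    exact hq₁a (by rw [hq]; simp [h0])
  have hqab : 0 < q.eval a * q.eval b := by
    by_contra! hcon
    obtain ⟨c, h1, h2, h3⟩ := hK.exists_root hab (hcon.lt_of_ne (mul_ne_zero hqa hqb))
    exact h c h1 h2 (by rw [hq₁, hq]; simp [h3])
  set r : K[X] := (m + 1 : K[X]) * (Polynomial.X - Polynomial.C b) * q + (n + 1 : K[X]) * (Polynomial.X - Polynomial.C a) * q +
    (Polynomial.X - Polynomial.C a) * (Polynomial.X - Polynomial.C b) * q.derivative with hr
  have hder : p.derivative = (Polynomial.X - Polynomial.C a) ^ m * (Polynomial.X - Polynomial.C b) ^ n * r := by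
    rw [hq₁, hq]
    simp only [derivative_mul, derivative_X_sub_C_pow, Nat.succ_eq_add_one, hr]
    push_cast
    simp
    ring
  have hra : r.eval a = (m + 1) * (a - b) * q.eval a := by simp [hr]
  have hrb : r.eval b = (n + 1) * (b - a) * q.eval b := by simp [hr]
  obtain ⟨c, h1, h2, h3⟩ := hK.exists_root (p := r) hab (by
    rw [hra, hrb]
    have : (0 : K) < (m + 1) * (n + 1) * ((b - a) * (b - a)) * (q.eval a * q.eval b) := by
      have := sub_pos.2 hab
      positivity
    linarith)
  exact ⟨c, h1, h2, by rw [hder]; simp [h3]⟩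

theorem rolle (hK : PolynomialIVT K) {p : K[X]} {a b : K} (hab : a < b) (ha : p.eval a = 0) (hb : p.eval b = 0) :
    ∃ c, a < c ∧ c < b ∧ p.derivative.eval c = 0 := by
  classical
  rcases eq_or_ne p 0 with rfl | hp
  · obtain ⟨c, h1, h2⟩ := exists_between hab
    exact ⟨c, h1, h2, by simp⟩
  have hne : (p.roots.toFinset.filter (a < ·)).Nonempty := ⟨b, by simp [hp, hb, hab]⟩
  obtain ⟨c, hc, hmin⟩ := Finset.exists_min_image _ id hne
  simp only [Finset.mem_filter, Multiset.mem_toFinset, mem_roots hp, IsRoot.def, id,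
    and_imp] at hc hmin
  obtain ⟨d, h1, h2, h3⟩ := hK.rolle_of_consecutive hp hc.2 ha hc.1
    (fun x hx hxc h0 ↦ (hmin x h0 hx).not_gt hxc)
  exact ⟨d, h1, h2.trans_le (hmin b hb hab), h3⟩

theorem mean_value (hK : PolynomialIVT K) (p : K[X]) {a b : K} (hab : a < b) :
    ∃ c, a < c ∧ c < b ∧ p.eval b - p.eval a = p.derivative.eval c * (b - a) := by
  have hne : b - a ≠ 0 := (sub_pos.2 hab).ne'
  obtain ⟨c, h1, h2, h3⟩ := hK.rolle
    (p := p - Polynomial.C ((p.eval b - p.eval a) / (b - a)) * (Polynomial.X - Polynomial.C a) - Polynomial.C (p.eval a)) hab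
    (by simp) (by simp [hne])
  refine ⟨c, h1, h2, ?_⟩
  simp [sub_eq_zero] at h3
  rw [h3]
  field_simp

theorem eval_lt_eval (hK : PolynomialIVT K) {p : K[X]} {a b : K} (hab : a < b)
    (h : ∀ x, a < x → x < b → 0 < p.derivative.eval x) : p.eval a < p.eval b := by
  obtain ⟨c, h1, h2, h3⟩ := hK.mean_value p hab
  have := mul_pos (h c h1 h2) (sub_pos.2 hab)
  linarith

end PolynomialIVT

section SameCut

variable {K₁ K₂ : Type*} [LinearOrder K₁] [LinearOrder K₂]

/-- `y` and `z` lie in corresponding positions with respect to the paired points in `Z`. -/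
def SameCut (Z : Finset (K₁ × K₂)) (y : K₁) (z : K₂) : Prop :=
  ∀ q ∈ Z, (q.1 < y ↔ q.2 < z) ∧ (y < q.1 ↔ z < q.2)

variable {Z : Finset (K₁ × K₂)} {y y' : K₁} {z z' : K₂}

theorem SameCut.swap (h : SameCut Z y z) : SameCut (Z.map (Equiv.prodComm K₁ K₂).toEmbedding) z y := by
  intro q hq
  simp only [Finset.mem_map_equiv] at hq
  have := h _ hq
  exact ⟨this.1.symm, this.2.symm⟩

theorem SameCut.trans (h₁ : SameCut Z y z) (h₂ : SameCut Z y z') (h₃ : SameCut Z y' z) :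
    SameCut Z y' z' := fun q hq ↦
  ⟨(h₃ q hq).1.trans ((h₁ q hq).1.symm.trans (h₂ q hq).1),
    (h₃ q hq).2.trans ((h₁ q hq).2.symm.trans (h₂ q hq).2)⟩

theorem SameCut.mono {Z' : Finset (K₁ × K₂)} (h : SameCut Z' y z) (hZ : Z ⊆ Z') : SameCut Z y z :=
  fun q hq ↦ h q (hZ hq)

theorem SameCut.eq_of_mem (h : SameCut Z y z) (hy : (y, z') ∈ Z) : z' = z := by
  have := h _ hy
  simp only [lt_self_iff_false, false_iff, not_lt] at this
  exact le_antisymm this.2 this.1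

theorem SameCut.between {y₀ y₁ : K₁} (h₀ : SameCut Z y₀ z) (h₁ : SameCut Z y₁ z)
    (hy₀ : y₀ < y) (hy₁ : y < y₁) : SameCut Z y z := fun q hq ↦
  ⟨⟨fun h ↦ (h₁ q hq).1.1 (h.trans hy₁), fun h ↦ ((h₀ q hq).1.2 h).trans hy₀⟩,
    ⟨fun h ↦ (h₀ q hq).2.1 (hy₀.trans h), fun h ↦ hy₁.trans ((h₁ q hq).2.2 h)⟩⟩

theorem SameCut.between_right {z₀ z₁ : K₂} (h₀ : SameCut Z y z₀) (h₁ : SameCut Z y z₁)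
    (hz₀ : z₀ < z) (hz₁ : z < z₁) : SameCut Z y z := by
  have := (h₀.swap.between h₁.swap hz₀ hz₁).swap
  rw [Finset.map_map] at this
  convert this
  ext
  simp

theorem exists_sameCut [DenselyOrdered K₂] [NoMinOrder K₂] [NoMaxOrder K₂] [Nonempty K₂]
    (hZ : ∀ q ∈ Z, SameCut Z q.1 q.2) (y : K₁) : ∃ z, SameCut Z y z := by
  have h : ∀ p ∈ Z, ∀ q ∈ Z, cmp p.1 q.1 = cmp p.2 q.2 := by
    intro p hp q hq
    have := hZ q hq p hp
    rcases lt_trichotomy p.1 q.1 with h | h | h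
    · rw [h.cmp_eq_lt, (this.1.1 h).cmp_eq_lt]
    · rw [h, cmp_self_eq_eq, eq_comm, cmp_eq_eq_iff]
      exact le_antisymm (not_lt.1 (mt this.2.2 h.not_gt)) (not_lt.1 (mt this.1.2 h.not_lt))
    · rw [h.cmp_eq_gt, (this.2.1 h).cmp_eq_gt]
  obtain ⟨z, hz⟩ := Order.PartialIso.exists_across ⟨Z, h⟩ y
  refine ⟨z, fun q hq ↦ ⟨lt_iff_lt_of_cmp_eq_cmp (hz q hq), ?_⟩⟩
  exact lt_iff_lt_of_cmp_eq_cmp (cmp_eq_cmp_symm.1 (hz q hq))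

end SameCut

section Extension

variable {K₁ K₂ : Type*} [Field K₁] [LinearOrder K₁] [Field K₂] [LinearOrder K₂]

/-- The finite set `Z` of pairs matches the derivatives of `p₁` and `p₂` everywhere, and `p₁` and
`p₂` themselves at the points of `Z`. -/
structure DerivativeMatching (Z : Finset (K₁ × K₂)) (p₁ : K₁[X]) (p₂ : K₂[X]) : Prop where
  natDegree₁ : p₁.natDegree ≠ 0
  natDegree₂ : p₂.natDegree ≠ 0
  sameCut : ∀ q ∈ Z, SameCut Z q.1 q.2
  sign_derivative : ∀ y z, SameCut Z y z →
    SignType.sign (p₁.derivative.eval y) = SignType.sign (p₂.derivative.eval z)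
  roots₁ : ∀ y, p₁.derivative.eval y = 0 → ∃ z, (y, z) ∈ Z
  roots₂ : ∀ z, p₂.derivative.eval z = 0 → ∃ y, (y, z) ∈ Z
  sign_eval : ∀ q ∈ Z, SignType.sign (p₁.eval q.1) = SignType.sign (p₂.eval q.2)

namespace DerivativeMatching

variable {Z : Finset (K₁ × K₂)} {p₁ : K₁[X]} {p₂ : K₂[X]} {y : K₁} {z : K₂}

theorem swap (D : DerivativeMatching Z p₁ p₂) :
    DerivativeMatching (Z.map (Equiv.prodComm K₁ K₂).toEmbedding) p₂ p₁ where
  natDegree₁ := D.natDegree₂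
  natDegree₂ := D.natDegree₁
  sameCut q hq := by
    simp only [Finset.mem_map_equiv] at hq
    exact (D.sameCut _ hq).swap
  sign_derivative z y h := by
    refine (D.sign_derivative y z ?_).symm
    intro q hq
    have := h q.swap (by simpa using hq)
    exact ⟨this.1.symm, this.2.symm⟩
  roots₁ z hz := by simpa using D.roots₂ z hz
  roots₂ y hy := by simpa using D.roots₁ y hy
  sign_eval q hq := by
    simp only [Finset.mem_map_equiv] at hq
    exact (D.sign_eval _ hq).symm

variable [IsStrictOrderedRing K₁]

theorem lt_of_roots_lt (hK₁ : PolynomialIVT K₁) (D : DerivativeMatching Z p₁ p₂)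
    {y' : K₁} {z' : K₂} (h : SameCut Z y z) (h' : SameCut Z y' z') (hy : p₁.eval y = 0)
    (hy' : p₁.eval y' = 0) (hlt : y < y') : z < z' := by
  obtain ⟨c, h1, h2, h3⟩ := hK₁.rolle hlt hy hy'
  obtain ⟨s, hs⟩ := D.roots₁ c h3
  exact ((h _ hs).2.1 h1).trans ((h' _ hs).1.1 h2)

variable [IsStrictOrderedRing K₂]

theorem neg (D : DerivativeMatching Z p₁ p₂) : DerivativeMatching Z (-p₁) (-p₂) where
  natDegree₁ := by simpa using D.natDegree₁
  natDegree₂ := by simpa using D.natDegree₂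
  sameCut := D.sameCut
  sign_derivative y z h := by
    simp only [derivative_neg, Polynomial.eval_neg, Left.sign_neg, D.sign_derivative y z h]
  roots₁ y hy := D.roots₁ y (by simpa using hy)
  roots₂ z hz := D.roots₂ z (by simpa using hz)
  sign_eval q hq := by simp only [Polynomial.eval_neg, Left.sign_neg, D.sign_eval q hq]

theorem exists_root_of_derivative_pos (hK₁ : PolynomialIVT K₁) (hK₂ : PolynomialIVT K₂)
    (D : DerivativeMatching Z p₁ p₂) (hyz : SameCut Z y z) (hy : ∀ s, (y, s) ∉ Z)
    (hd : 0 < p₁.derivative.eval y) (h₁ : 0 ≤ p₁.eval y) (h₂ : p₂.eval z < 0) :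
    ∃ z', SameCut Z y z' ∧ p₂.eval z' = 0 := by
  have hd₂ : 0 < p₂.derivative.eval z := by
    rw [← sign_eq_one_iff, ← D.sign_derivative y z hyz, sign_eq_one_iff]
    exact hd
  -- it suffices to find a positive value of `p₂` at or before the next point of `Z`
  suffices h : ∃ w > z, 0 < p₂.eval w ∧ ∀ q ∈ Z, z < q.2 → w ≤ q.2 by
    obtain ⟨w, hzw, hw, hmin⟩ := h
    obtain ⟨z', h1, h2, h3⟩ := hK₂ p₂ z w hzw h₂ hw
    refine ⟨z', fun q hq ↦ ?_, h3⟩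
    have hc := hyz q hq
    rcases lt_trichotomy q.1 y with h | h | h
    · have := (hc.1.1 h).trans h1
      exact ⟨iff_of_true h this, iff_of_false h.not_gt this.not_gt⟩
    · exact absurd (show (y, q.2) ∈ Z by rw [← h]; exact hq) (hy _)
    · have := h2.trans_le (hmin q hq (hc.2.1 h))
      exact ⟨iff_of_false h.not_gt this.not_gt, iff_of_true h this⟩
  rcases (Z.filter (fun q ↦ y < q.1)).eq_empty_or_nonempty with hT | hT
  · rw [Finset.filter_eq_empty_iff] at hT
    have hpos : ∀ x > z, 0 < p₂.derivative.eval x := by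
      intro x hx
      by_contra! hcon
      have hne : SignType.sign (p₂.derivative.eval z) ≠ SignType.sign (p₂.derivative.eval x) := by
        rw [sign_pos hd₂]
        intro h
        exact hcon.not_gt (sign_eq_one_iff.1 h.symm)
      obtain ⟨c, hc, hc0⟩ := hK₂.exists_root_uIcc hne
      obtain ⟨r, hr⟩ := D.roots₂ c hc0
      rw [Set.uIcc_of_le hx.le] at hc
      have hzc : z < c := hc.1.lt_of_ne (by rintro rfl; exact hd₂.ne' hc0)
      exact hT hr ((hyz _ hr).2.2 hzc)
    obtain ⟨w, hw, hw'⟩ := exists_gt_eval_pos_of_derivative_pos D.natDegree₂ hpos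
    exact ⟨w, hw, hw', fun q hq hzq ↦ absurd ((hyz q hq).2.2 hzq) (hT hq)⟩
  · obtain ⟨q, hq, hmin⟩ := Finset.exists_min_image _ Prod.fst hT
    simp only [Finset.mem_filter, and_imp] at hq hmin
    have hpos : ∀ x, y < x → x < q.1 → 0 < p₁.derivative.eval x := by
      intro x hx hxq
      by_contra! hcon
      have hne : SignType.sign (p₁.derivative.eval y) ≠ SignType.sign (p₁.derivative.eval x) := by
        rw [sign_pos hd]
        intro h
        exact hcon.not_gt (sign_eq_one_iff.1 h.symm)
      obtain ⟨c, hc, hc0⟩ := hK₁.exists_root_uIcc hne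
      obtain ⟨s, hs⟩ := D.roots₁ c hc0
      rw [Set.uIcc_of_le hx.le] at hc
      have hyc : y < c := hc.1.lt_of_ne (by rintro rfl; exact hd.ne' hc0)
      exact (hmin _ hs hyc).not_gt (hc.2.trans_lt hxq)
    have hq₁ : 0 < p₁.eval q.1 := h₁.trans_lt (hK₁.eval_lt_eval hq.2 hpos)
    refine ⟨q.2, (hyz q hq.1).2.1 hq.2, ?_, fun q' hq' hzq' ↦ ?_⟩
    · rw [← sign_eq_one_iff, ← D.sign_eval q hq.1, sign_eq_one_iff]
      exact hq₁
    · have := hmin q' hq' ((hyz q' hq').2.2 hzq')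
      exact not_lt.1 (mt (D.sameCut q hq.1 q' hq').1.2 this.not_gt)

theorem exists_root_of_derivative_neg (hK₁ : PolynomialIVT K₁) (hK₂ : PolynomialIVT K₂)
    (D : DerivativeMatching Z p₁ p₂) (hyz : SameCut Z y z) (hy : ∀ s, (y, s) ∉ Z)
    (hd : p₁.derivative.eval y < 0) (h₁ : 0 ≤ p₁.eval y) (h₂ : p₂.eval z < 0) :
    ∃ z', SameCut Z y z' ∧ p₂.eval z' = 0 := by
  let e : K₁ × K₂ ≃ K₁ × K₂ := (Equiv.neg K₁).prodCongr (Equiv.neg K₂)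
  have hmem (q : K₁ × K₂) : q ∈ Z.map e.toEmbedding ↔ (-q.1, -q.2) ∈ Z := by
    rw [Finset.mem_map_equiv]
    rfl
  have hcut {a : K₁} {b : K₂} : SameCut (Z.map e.toEmbedding) a b ↔ SameCut Z (-a) (-b) := by
    constructor
    · intro h q hq
      have := h (-q.1, -q.2) ((hmem _).2 (by simpa using hq))
      constructor
      · rw [lt_neg, this.2, lt_neg]
      · rw [neg_lt, this.1, neg_lt]
    · intro h q hq
      have := h _ ((hmem _).1 hq)
      simp only [neg_lt_neg_iff] at this
      exact ⟨this.2, this.1⟩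
  have D' : DerivativeMatching (Z.map e.toEmbedding) (p₁.comp (-Polynomial.X)) (p₂.comp (-Polynomial.X)) :=
    { natDegree₁ := by simpa [natDegree_comp] using D.natDegree₁
      natDegree₂ := by simpa [natDegree_comp] using D.natDegree₂
      sameCut := fun q hq ↦ hcut.2 (D.sameCut _ ((hmem q).1 hq))
      sign_derivative := fun a b h ↦ by
        have := D.sign_derivative _ _ (hcut.1 h)
        simpa [derivative_comp, Left.sign_neg] using this
      roots₁ := fun a ha ↦ by
        obtain ⟨b, hb⟩ := D.roots₁ (-a) (by simpa [derivative_comp] using ha)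
        exact ⟨-b, (hmem _).2 (by simpa using hb)⟩
      roots₂ := fun b hb ↦ by
        obtain ⟨a, ha⟩ := D.roots₂ (-b) (by simpa [derivative_comp] using hb)
        exact ⟨-a, (hmem _).2 (by simpa using ha)⟩
      sign_eval := fun q hq ↦ by simpa using D.sign_eval _ ((hmem q).1 hq) }
  obtain ⟨z', h1, h2⟩ := D'.exists_root_of_derivative_pos hK₁ hK₂ (y := -y) (z := -z)
    (hcut.2 (by simpa using hyz)) (fun s hs ↦ hy (-s) (by simpa using (hmem _).1 hs))
    (by simpa [derivative_comp] using hd) (by simpa using h₁) (by simpa using h₂)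
  exact ⟨-z', by simpa using hcut.1 h1, by simpa using h2⟩

theorem exists_root_of_nonneg_of_neg (hK₁ : PolynomialIVT K₁) (hK₂ : PolynomialIVT K₂)
    (D : DerivativeMatching Z p₁ p₂) (hyz : SameCut Z y z) (hy : ∀ s, (y, s) ∉ Z)
    (h₁ : 0 ≤ p₁.eval y) (h₂ : p₂.eval z < 0) :
    ∃ z', SameCut Z y z' ∧ p₂.eval z' = 0 := by
  rcases lt_trichotomy (p₁.derivative.eval y) 0 with hd | hd | hd
  · exact D.exists_root_of_derivative_neg hK₁ hK₂ hyz hy hd h₁ h₂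
  · obtain ⟨s, hs⟩ := D.roots₁ y hd
    exact absurd hs (hy s)
  · exact D.exists_root_of_derivative_pos hK₁ hK₂ hyz hy hd h₁ h₂

theorem exists_root_of_root (hK₁ : PolynomialIVT K₁) (hK₂ : PolynomialIVT K₂)
    (D : DerivativeMatching Z p₁ p₂) (h : p₁.eval y = 0) :
    ∃ z, SameCut Z y z ∧ p₂.eval z = 0 := by
  by_cases hy : ∃ s, (y, s) ∈ Z
  · obtain ⟨s, hs⟩ := hy
    refine ⟨s, D.sameCut _ hs, ?_⟩
    have := D.sign_eval _ hs
    rwa [h, sign_zero, eq_comm, sign_eq_zero_iff] at this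
  push Not at hy
  obtain ⟨z, hz⟩ := exists_sameCut D.sameCut y
  rcases lt_trichotomy (p₂.eval z) 0 with h' | h' | h'
  · exact D.exists_root_of_nonneg_of_neg hK₁ hK₂ hz hy h.ge h'
  · exact ⟨z, hz, h'⟩
  · obtain ⟨z', h1, h2⟩ := D.neg.exists_root_of_nonneg_of_neg hK₁ hK₂ hz hy (by simp [h])
      (by simpa using h')
    exact ⟨z', h1, by simpa using h2⟩

theorem not_pos_and_neg (hK₁ : PolynomialIVT K₁) (hK₂ : PolynomialIVT K₂)
    (D : DerivativeMatching Z p₁ p₂) (hyz : SameCut Z y z) (hy : ∀ s, (y, s) ∉ Z)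
    (hroots : ∀ y' z', SameCut Z y' z' → p₁.eval y' = 0 → p₂.eval z' = 0 →
      (y' < y ↔ z' < z) ∧ (y < y' ↔ z < z')) (h₁ : 0 < p₁.eval y) : ¬ p₂.eval z < 0 := by
  intro h₂
  have hz : ∀ s, (z, s) ∉ Z.map (Equiv.prodComm K₁ K₂).toEmbedding := by
    intro s hs
    obtain rfl := hyz.swap.eq_of_mem hs
    exact hy z (by simpa using hs)
  obtain ⟨z', hz', hz'0⟩ := D.exists_root_of_nonneg_of_neg hK₁ hK₂ hyz hy h₁.le h₂
  obtain ⟨y', hy', hy'0⟩ := D.swap.neg.exists_root_of_nonneg_of_neg hK₂ hK₁ hyz.swap hz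
    (by simpa using h₂.le) (by simpa using h₁)
  have hy'z : SameCut Z y' z := by
    intro q hq
    have := hy' q.swap (by simpa using hq)
    exact ⟨this.1.symm, this.2.symm⟩
  replace hy'0 : p₁.eval y' = 0 := by simpa using hy'0
  have hcmp := hroots y' z' (hyz.trans hz' hy'z) hy'0 hz'0
  have hcut : SameCut Z y' z' := hyz.trans hz' hy'z
  rcases lt_trichotomy y' y with hlt | rfl | hlt
  · have hlt' := hcmp.1.1 hlt
    obtain ⟨a, ha1, ha2, ha⟩ := hK₁.mean_value p₁ hlt
    obtain ⟨b, hb1, hb2, hb⟩ := hK₂.mean_value p₂ hlt'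
    have hs := D.sign_derivative a b
      ((hcut.between hz' ha1 ha2).between_right (hy'z.between hyz ha1 ha2) hb1 hb2)
    have ha' : 0 < p₁.derivative.eval a := by
      by_contra! hcon
      nlinarith [sub_pos.2 hlt]
    rw [sign_pos ha', eq_comm, sign_eq_one_iff] at hs
    nlinarith [sub_pos.2 hlt']
  · exact h₁.ne' hy'0
  · have hlt' := hcmp.2.1 hlt
    obtain ⟨a, ha1, ha2, ha⟩ := hK₁.mean_value p₁ hlt
    obtain ⟨b, hb1, hb2, hb⟩ := hK₂.mean_value p₂ hlt'
    have hs := D.sign_derivative a b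
      ((hyz.between hy'z ha1 ha2).between_right (hz'.between hcut ha1 ha2) hb1 hb2)
    have ha' : p₁.derivative.eval a < 0 := by
      by_contra! hcon
      nlinarith [sub_pos.2 hlt]
    rw [sign_neg ha', eq_comm, sign_eq_neg_one_iff] at hs
    nlinarith [sub_pos.2 hlt']

/-- A matching of the derivatives extends to a matching of the polynomials. -/
theorem exists_extension (hK₁ : PolynomialIVT K₁) (hK₂ : PolynomialIVT K₂)
    (D : DerivativeMatching Z p₁ p₂) : ∃ Z', Z ⊆ Z' ∧ (∀ q ∈ Z', SameCut Z' q.1 q.2) ∧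
      (∀ y z, SameCut Z' y z → SignType.sign (p₁.eval y) = SignType.sign (p₂.eval z)) ∧
      (∀ y, p₁.eval y = 0 → ∃ z, (y, z) ∈ Z') ∧ ∀ z, p₂.eval z = 0 → ∃ y, (y, z) ∈ Z' := by
  classical
  have hp₁ : p₁ ≠ 0 := ne_zero_of_natDegree_gt (Nat.pos_of_ne_zero D.natDegree₁)
  have hp₂ : p₂ ≠ 0 := ne_zero_of_natDegree_gt (Nat.pos_of_ne_zero D.natDegree₂)
  set Z' := Z ∪ (p₁.roots.toFinset ×ˢ p₂.roots.toFinset).filter (fun q ↦ SameCut Z q.1 q.2)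
    with hZ'
  have hmem (q : K₁ × K₂) :
      q ∈ Z' ↔ q ∈ Z ∨ (p₁.eval q.1 = 0 ∧ p₂.eval q.2 = 0) ∧ SameCut Z q.1 q.2 := by
    simp [hZ', hp₁, hp₂]
  have hsub : Z ⊆ Z' := Finset.subset_union_left
  have hcutZ (q : K₁ × K₂) (hq : q ∈ Z') : SameCut Z q.1 q.2 := by
    rcases (hmem q).1 hq with h | h
    · exact D.sameCut q h
    · exact h.2
  have hnew (q q' : K₁ × K₂) (hq : q ∈ Z') (hq' : q' ∈ Z') : q.1 < q'.1 ↔ q.2 < q'.2 := by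
    rcases (hmem q).1 hq with h | h
    · exact (hcutZ q' hq' q h).1
    rcases (hmem q').1 hq' with h' | h'
    · exact (hcutZ q hq q' h').2
    exact ⟨D.lt_of_roots_lt hK₁ h.2 h'.2 h.1.1 h'.1.1,
      D.swap.lt_of_roots_lt hK₂ h.2.swap h'.2.swap h.1.2 h'.1.2⟩
  have hroots₁ (y : K₁) (hy : p₁.eval y = 0) : ∃ z, (y, z) ∈ Z' ∧ p₂.eval z = 0 := by
    obtain ⟨z, hz, hz0⟩ := D.exists_root_of_root hK₁ hK₂ hy
    exact ⟨z, (hmem _).2 (.inr ⟨⟨hy, hz0⟩, hz⟩), hz0⟩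
  have hroots₂ (z : K₂) (hz : p₂.eval z = 0) : ∃ y, (y, z) ∈ Z' ∧ p₁.eval y = 0 := by
    obtain ⟨y, hy, hy0⟩ := D.swap.exists_root_of_root hK₂ hK₁ hz
    refine ⟨y, (hmem _).2 (.inr ⟨⟨hy0, hz⟩, fun q hq ↦ ?_⟩), hy0⟩
    have := hy q.swap (by simpa using hq)
    exact ⟨this.1.symm, this.2.symm⟩
  refine ⟨Z', hsub, fun q hq q' hq' ↦ ⟨hnew q' q hq' hq, hnew q q' hq hq'⟩, fun y z hyz ↦ ?_,
    fun y hy ↦ (hroots₁ y hy).imp fun _ h ↦ h.1, fun z hz ↦ (hroots₂ z hz).imp fun _ h ↦ h.1⟩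
  by_cases hy : ∃ s, (y, s) ∈ Z
  · obtain ⟨s, hs⟩ := hy
    obtain rfl := hyz.eq_of_mem (hsub hs)
    exact D.sign_eval _ hs
  push Not at hy
  have hcmp (y' : K₁) (z' : K₂) (h : SameCut Z y' z') (h₁ : p₁.eval y' = 0)
      (h₂ : p₂.eval z' = 0) : (y' < y ↔ z' < z) ∧ (y < y' ↔ z < z') :=
    hyz (y', z') ((hmem (y', z')).2 (.inr ⟨⟨h₁, h₂⟩, h⟩))
  by_cases hy0 : p₁.eval y = 0
  · obtain ⟨s, hs, hs0⟩ := hroots₁ y hy0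
    obtain rfl := hyz.eq_of_mem hs
    rw [hy0, hs0, sign_zero, sign_zero]
  by_cases hz0 : p₂.eval z = 0
  · obtain ⟨r, hr, hr0⟩ := hroots₂ z hz0
    obtain rfl := hyz.swap.eq_of_mem (z' := r) (by simpa using hr)
    exact absurd hr0 hy0
  rcases lt_or_gt_of_ne hy0 with h₁ | h₁ <;> rcases lt_or_gt_of_ne hz0 with h₂ | h₂
  · rw [sign_neg h₁, sign_neg h₂]
  · exact absurd (by simpa using h₂) (D.neg.not_pos_and_neg hK₁ hK₂ (hyz.mono hsub) hy
      (fun y' z' h h1 h2 ↦ hcmp y' z' h (by simpa using h1) (by simpa using h2))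
      (by simpa using h₁))
  · exact absurd h₂ (D.not_pos_and_neg hK₁ hK₂ (hyz.mono hsub) hy hcmp h₁)
  · rw [sign_pos h₁, sign_pos h₂]

end DerivativeMatching

end Extension

section Matching

variable {F K₁ K₂ : Type*} [Field F] [Field K₁] [LinearOrder K₁] [Field K₂] [LinearOrder K₂]
  {φ₁ : F →+* K₁} {φ₂ : F →+* K₂} {Z : Finset (K₁ × K₂)} {G : Finset F[X]}

variable (φ₁ φ₂) in
/-- The finite set `Z` of pairs matches the signs of all polynomials in `G` and contains all of
their roots. -/
structure SignMatching (G : Finset F[X]) (Z : Finset (K₁ × K₂)) : Prop where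
  sameCut : ∀ q ∈ Z, SameCut Z q.1 q.2
  sign_eval : ∀ y z, SameCut Z y z → ∀ g ∈ G,
    SignType.sign (g.eval₂ φ₁ y) = SignType.sign (g.eval₂ φ₂ z)
  roots₁ : ∀ g ∈ G, g ≠ 0 → ∀ y, g.eval₂ φ₁ y = 0 → ∃ z, (y, z) ∈ Z
  roots₂ : ∀ g ∈ G, g ≠ 0 → ∀ z, g.eval₂ φ₂ z = 0 → ∃ y, (y, z) ∈ Z

namespace SignMatching

theorem mono {G' : Finset F[X]} (M : SignMatching φ₁ φ₂ G Z) (h : G' ⊆ G) :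
    SignMatching φ₁ φ₂ G' Z where
  sameCut := M.sameCut
  sign_eval y z hyz g hg := M.sign_eval y z hyz g (h hg)
  roots₁ g hg := M.roots₁ g (h hg)
  roots₂ g hg := M.roots₂ g (h hg)

theorem of_natDegree_eq_zero (hφ : ∀ c, SignType.sign (φ₁ c) = SignType.sign (φ₂ c))
    (hG : ∀ g ∈ G, g.natDegree = 0) : SignMatching φ₁ φ₂ G ∅ where
  sameCut := by simp
  sign_eval y z _ g hg := by
    rw [eq_C_of_natDegree_eq_zero (hG g hg), Polynomial.eval₂_C, Polynomial.eval₂_C, hφ]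
  roots₁ g hg hg0 y hy := by
    rw [eq_C_of_natDegree_eq_zero (hG g hg)] at hg0 hy
    rw [Polynomial.eval₂_C, map_eq_zero] at hy
    simp [hy] at hg0
  roots₂ g hg hg0 y hy := by
    rw [eq_C_of_natDegree_eq_zero (hG g hg)] at hg0 hy
    rw [Polynomial.eval₂_C, map_eq_zero] at hy
    simp [hy] at hg0

variable [IsStrictOrderedRing K₂]

open Classical in
theorem filter_roots (hK₂ : PolynomialIVT K₂) (M : SignMatching φ₁ φ₂ G Z) :
    SignMatching φ₁ φ₂ G (Z.filter fun q ↦ ∃ g ∈ G, g ≠ 0 ∧ g.eval₂ φ₁ q.1 = 0) where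
  sameCut q hq := (M.sameCut q (Finset.mem_filter.1 hq).1).mono (Finset.filter_subset _ _)
  sign_eval y z hyz g hg := by
    obtain ⟨z', hz'⟩ := exists_sameCut M.sameCut y
    rw [M.sign_eval y z' hz' g hg]
    rcases eq_or_ne g 0 with rfl | hg0
    · simp
    by_contra hne
    simp only [← Polynomial.eval_map] at hne
    obtain ⟨w, hw, hw0⟩ := hK₂.exists_root_uIcc hne
    rw [Polynomial.eval_map] at hw0
    obtain ⟨r, hr⟩ := M.roots₂ g hg hg0 w hw0
    have hr0 : g.eval₂ φ₁ r = 0 := by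
      have := M.sign_eval r w (M.sameCut _ hr) g hg
      rwa [hw0, sign_zero, sign_eq_zero_iff] at this
    have h₁ := hyz (r, w) (Finset.mem_filter.2 ⟨hr, g, hg, hg0, hr0⟩)
    have h₂ := hz' (r, w) hr
    have hwz : w = z := by
      simp only at h₁ h₂
      rcases Set.mem_uIcc.1 hw with ⟨ha, hb⟩ | ⟨ha, hb⟩
      · refine le_antisymm hb (not_lt.1 fun hlt ↦ ?_)
        exact ha.not_gt (h₂.1.1 (h₁.1.2 hlt))
      · refine le_antisymm (not_lt.1 fun hlt ↦ ?_) ha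
        exact hb.not_gt (h₂.2.1 (h₁.2.2 hlt))
    have hwz' : w = z' := by
      simp only at h₁ h₂
      subst hwz
      simp only [lt_self_iff_false, iff_false] at h₁
      exact le_antisymm (not_lt.1 (mt h₂.2.2 h₁.2)) (not_lt.1 (mt h₂.1.2 h₁.1))
    exact hne (by rw [← hwz, ← hwz'])
  roots₁ g hg hg0 y hy := by
    obtain ⟨z, hz⟩ := M.roots₁ g hg hg0 y hy
    exact ⟨z, Finset.mem_filter.2 ⟨hz, g, hg, hg0, hy⟩⟩
  roots₂ g hg hg0 z hz := by
    obtain ⟨y, hy⟩ := M.roots₂ g hg hg0 z hz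
    refine ⟨y, Finset.mem_filter.2 ⟨hy, g, hg, hg0, ?_⟩⟩
    have := M.sign_eval y z (M.sameCut _ hy) g hg
    rwa [hz, sign_zero, sign_eq_zero_iff] at this

variable [CharZero F] [IsStrictOrderedRing K₁]

open Classical in
theorem exists_insert (hK₁ : PolynomialIVT K₁) (hK₂ : PolynomialIVT K₂) {p : F[X]}
    (hp : p.natDegree ≠ 0) (hpG : derivative p ∈ G)
    (M : SignMatching φ₁ φ₂ (G ∪ (G.erase 0).image (p % ·)) Z) :
    ∃ Z', SignMatching φ₁ φ₂ (insert p G) Z' := by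
  have M' := (M.mono Finset.subset_union_left).filter_roots hK₂
  set Z' := Z.filter fun q ↦ ∃ g ∈ G, g ≠ 0 ∧ g.eval₂ φ₁ q.1 = 0
  have hd : derivative p ≠ 0 := fun h ↦ hp (derivative_eq_zero.1 h)
  have D : DerivativeMatching Z' (p.map φ₁) (p.map φ₂) := {
    natDegree₁ := by rwa [natDegree_map]
    natDegree₂ := by rwa [natDegree_map]
    sameCut := M'.sameCut
    sign_derivative := fun y z h ↦ by
      simpa only [derivative_map, Polynomial.eval_map] using M'.sign_eval y z h _ hpG
    roots₁ := fun y hy ↦ M'.roots₁ _ hpG hd y (by rwa [derivative_map, Polynomial.eval_map] at hy)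
    roots₂ := fun z hz ↦ M'.roots₂ _ hpG hd z (by rwa [derivative_map, Polynomial.eval_map] at hz)
    sign_eval := fun q hq ↦ by
      obtain ⟨hqZ, g, hg, hg0, hq0⟩ := Finset.mem_filter.1 hq
      have hcut := M.sameCut q hqZ
      have hq0' : g.eval₂ φ₂ q.2 = 0 := by
        have := M.sign_eval _ _ hcut g (Finset.mem_union_left _ hg)
        rwa [hq0, sign_zero, eq_comm, sign_eq_zero_iff] at this
      have hr := M.sign_eval _ _ hcut (p % g) (Finset.mem_union_right _
        (Finset.mem_image_of_mem _ (Finset.mem_erase.2 ⟨hg0, hg⟩)))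
      rw [Polynomial.eval_map, Polynomial.eval_map, ← EuclideanDomain.div_add_mod p g, Polynomial.eval₂_add, Polynomial.eval₂_add, Polynomial.eval₂_mul,
        Polynomial.eval₂_mul, hq0, hq0', zero_mul, zero_mul, zero_add, zero_add, hr] }
  obtain ⟨Z'', hsub, hcut, hsign, hr₁, hr₂⟩ := D.exists_extension hK₁ hK₂
  refine ⟨Z'', hcut, fun y z hyz ↦ ?_, ?_, ?_⟩
  · simp only [Finset.forall_mem_insert]
    exact ⟨by simpa only [Polynomial.eval_map] using hsign y z hyz, M'.sign_eval y z (hyz.mono hsub)⟩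
  · simp only [Finset.forall_mem_insert]
    exact ⟨fun _ y hy ↦ hr₁ y (by rwa [Polynomial.eval_map]),
      fun g hg hg0 y hy ↦ (M'.roots₁ g hg hg0 y hy).imp fun _ h ↦ hsub h⟩
  · simp only [Finset.forall_mem_insert]
    exact ⟨fun _ y hy ↦ hr₂ y (by rwa [Polynomial.eval_map]),
      fun g hg hg0 y hy ↦ (M'.roots₂ g hg hg0 y hy).imp fun _ h ↦ hsub h⟩

open Classical in
theorem exists_union (hK₁ : PolynomialIVT K₁) (hK₂ : PolynomialIVT K₂) {d : ℕ}
    (ih : ∀ G : Finset F[X], (∀ g ∈ G, g.natDegree ≤ d) → ∃ Z, SignMatching φ₁ φ₂ G Z)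
    (H : Finset F[X]) (hH : ∀ g ∈ H, g.natDegree = d + 1) (G : Finset F[X])
    (hG : ∀ g ∈ G, g.natDegree ≤ d) : ∃ Z, SignMatching φ₁ φ₂ (H ∪ G) Z := by
  induction H using Finset.induction_on generalizing G with
  | empty => simpa using ih G hG
  | insert p H _ hrec =>
    have hp : p.natDegree = d + 1 := hH p (Finset.mem_insert_self _ _)
    have hH' : ∀ g ∈ H, g.natDegree = d + 1 := fun g hg ↦ hH g (Finset.mem_insert_of_mem hg)
    let G₁ := insert (derivative p) (H ∪ G)
    have hG₁ : ∀ g ∈ G₁, g.natDegree ≤ d + 1 := by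
      simp only [G₁, Finset.forall_mem_insert, Finset.mem_union]
      refine ⟨(natDegree_derivative_le p).trans (by omega), ?_⟩
      rintro g (hg | hg)
      · exact (hH' g hg).le
      · exact (hG g hg).trans (by omega)
    obtain ⟨Z, hZ⟩ := hrec hH' (insert (derivative p) (G ∪ (G₁.erase 0).image (p % ·))) (by
      simp only [Finset.forall_mem_insert, Finset.mem_union]
      refine ⟨(natDegree_derivative_le p).trans (by omega), ?_⟩
      rintro g (hg | hg)
      · exact hG g hg
      obtain ⟨r, hr, rfl⟩ := Finset.mem_image.1 hg
      obtain ⟨hr0, hr⟩ := Finset.mem_erase.1 hr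
      rcases eq_or_ne r.natDegree 0 with h0 | h0
      · rw [EuclideanDomain.mod_eq_zero.2]
        · simp
        · rw [eq_C_of_natDegree_eq_zero h0] at hr0 ⊢
          exact (isUnit_C.2 (IsUnit.mk0 _ (by simpa using hr0))).dvd
      · exact Nat.lt_succ_iff.1 ((natDegree_mod_lt p h0).trans_le (hG₁ r hr)))
    obtain ⟨Z', hZ'⟩ := exists_insert hK₁ hK₂ (p := p) (by omega) (Finset.mem_insert_self _ _)
      (hZ.mono (G' := G₁ ∪ (G₁.erase 0).image (p % ·)) (by
        intro g
        simp only [G₁, Finset.mem_union, Finset.mem_insert]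
        tauto))
    refine ⟨Z', hZ'.mono ?_⟩
    intro g
    simp only [Finset.mem_union, Finset.mem_insert]
    tauto

open Classical in
theorem exists_of_finset (hK₁ : PolynomialIVT K₁) (hK₂ : PolynomialIVT K₂)
    (hφ : ∀ c, SignType.sign (φ₁ c) = SignType.sign (φ₂ c)) (G : Finset F[X]) :
    ∃ Z, SignMatching φ₁ φ₂ G Z := by
  suffices h : ∀ d, ∀ G : Finset F[X], (∀ g ∈ G, g.natDegree ≤ d) → ∃ Z, SignMatching φ₁ φ₂ G Z from
    h (G.sup natDegree) G fun g hg ↦ Finset.le_sup (f := natDegree) hg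
  intro d
  induction d with
  | zero => exact fun G hG ↦ ⟨∅, of_natDegree_eq_zero hφ fun g hg ↦ Nat.le_zero.1 (hG g hg)⟩
  | succ d ih =>
    intro G hG
    obtain ⟨Z, hZ⟩ := exists_union hK₁ hK₂ ih (G.filter (·.natDegree = d + 1))
      (fun g hg ↦ (Finset.mem_filter.1 hg).2) (G.filter (·.natDegree ≤ d))
      (fun g hg ↦ (Finset.mem_filter.1 hg).2)
    refine ⟨Z, hZ.mono fun g hg ↦ ?_⟩
    have := hG g hg
    simp only [Finset.mem_union, Finset.mem_filter, hg, true_and]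
    omega

end SignMatching

variable [CharZero F] [IsStrictOrderedRing K₁] [IsStrictOrderedRing K₂]

theorem exists_sign_eval₂_eq (hK₁ : PolynomialIVT K₁) (hK₂ : PolynomialIVT K₂)
    (hφ : ∀ c, SignType.sign (φ₁ c) = SignType.sign (φ₂ c)) (G : Finset F[X]) (y : K₁) :
    ∃ z, ∀ g ∈ G, SignType.sign (g.eval₂ φ₁ y) = SignType.sign (g.eval₂ φ₂ z) := by
  obtain ⟨Z, hZ⟩ := SignMatching.exists_of_finset hK₁ hK₂ hφ G
  obtain ⟨z, hz⟩ := exists_sameCut hZ.sameCut y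
  exact ⟨z, hZ.sign_eval y z hz⟩

end Matching

theorem map_sign_inv {K : Type*} [Field K] [LinearOrder K] [IsStrictOrderedRing K] (x : K) :
    SignType.sign x⁻¹ = SignType.sign x := by
  rcases lt_trichotomy x 0 with h | rfl | h
  · rw [sign_neg h, sign_neg (inv_lt_zero.2 h)]
  · rw [inv_zero]
  · rw [sign_pos h, sign_pos (inv_pos.2 h)]

theorem exists_sign_eval₂_eq_of_commRing {A K₁ K₂ : Type*} [CommRing A]
    [Field K₁] [LinearOrder K₁] [IsStrictOrderedRing K₁]
    [Field K₂] [LinearOrder K₂] [IsStrictOrderedRing K₂] {φ₁ : A →+* K₁} {φ₂ : A →+* K₂}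
    (hK₁ : PolynomialIVT K₁) (hK₂ : PolynomialIVT K₂)
    (hφ : ∀ c, SignType.sign (φ₁ c) = SignType.sign (φ₂ c)) (G : Finset A[X]) (y : K₁) :
    ∃ z, ∀ g ∈ G, SignType.sign (g.eval₂ φ₁ y) = SignType.sign (g.eval₂ φ₂ z) := by
  classical
  let I := RingHom.ker φ₁
  have hI : ∀ a, φ₁ a = 0 ↔ φ₂ a = 0 := fun a ↦ by
    rw [← sign_eq_zero_iff, hφ, sign_eq_zero_iff]
  let ψ₁ : A ⧸ I →+* K₁ := RingHom.kerLift φ₁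
  have hψ₁ : Function.Injective ψ₁ := RingHom.kerLift_injective φ₁
  let ψ₂ : A ⧸ I →+* K₂ := Ideal.Quotient.lift I φ₂ fun a ha ↦ (hI a).1 ha
  have hψ₂ : Function.Injective ψ₂ := by
    rw [injective_iff_map_eq_zero]
    intro a
    obtain ⟨a, rfl⟩ := Ideal.Quotient.mk_surjective a
    intro h
    exact Ideal.Quotient.eq_zero_iff_mem.2 ((hI a).2 h)
  have : IsDomain (A ⧸ I) := hψ₁.isDomain ψ₁
  let θ₁ : FractionRing (A ⧸ I) →+* K₁ := IsFractionRing.lift hψ₁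
  let θ₂ : FractionRing (A ⧸ I) →+* K₂ := IsFractionRing.lift hψ₂
  have : CharZero (FractionRing (A ⧸ I)) := θ₁.charZero
  let ι : A →+* FractionRing (A ⧸ I) := (algebraMap _ _).comp (Ideal.Quotient.mk I)
  have h₁ : θ₁.comp ι = φ₁ := by
    ext a
    exact IsFractionRing.lift_algebraMap hψ₁ _
  have h₂ : θ₂.comp ι = φ₂ := by
    ext a
    exact IsFractionRing.lift_algebraMap hψ₂ _
  have hθ : ∀ c, SignType.sign (θ₁ c) = SignType.sign (θ₂ c) := by
    intro c
    obtain ⟨a, b, _, rfl⟩ := IsFractionRing.div_surjective (A ⧸ I) c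
    obtain ⟨a, rfl⟩ := Ideal.Quotient.mk_surjective a
    obtain ⟨b, rfl⟩ := Ideal.Quotient.mk_surjective b
    have e₁ (x : A) := DFunLike.congr_fun h₁ x
    have e₂ (x : A) := DFunLike.congr_fun h₂ x
    simp only [ι, RingHom.comp_apply] at e₁ e₂
    simp only [div_eq_mul_inv, map_mul, map_inv₀, sign_mul, map_sign_inv, e₁, e₂, hφ]
  obtain ⟨z, hz⟩ := exists_sign_eval₂_eq hK₁ hK₂ hθ (G.image (Polynomial.map ι)) y
  refine ⟨z, fun g hg ↦ ?_⟩
  have := hz _ (Finset.mem_image_of_mem _ hg)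
  rwa [Polynomial.eval₂_map, Polynomial.eval₂_map, h₁, h₂] at this

section Germ

open Filter

variable {Ω : Type*} {U : Ultrafilter Ω}

theorem Filter.Germ.sign_coe_eq_iff {a : Ω → ℝ} {s : SignType} :
    SignType.sign (a : Germ (U : Filter Ω) ℝ) = s ↔ ∀ᶠ ω in U, SignType.sign (a ω) = s := by
  have h0 : (0 : Germ (U : Filter Ω) ℝ) = ((fun _ ↦ 0 : Ω → ℝ) : Germ (U : Filter Ω) ℝ) := rfl
  rcases s with _ | _ | _
  · change SignType.sign _ = 0 ↔ ∀ᶠ ω in (U : Filter Ω), SignType.sign (a ω) = 0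
    simp only [sign_eq_zero_iff, h0, Germ.coe_eq]
    rfl
  · change SignType.sign _ = -1 ↔ ∀ᶠ ω in (U : Filter Ω), SignType.sign (a ω) = -1
    simp only [sign_eq_neg_one_iff, h0, Germ.coe_lt]
  · change SignType.sign _ = 1 ↔ ∀ᶠ ω in (U : Filter Ω), SignType.sign (a ω) = 1
    simp only [sign_eq_one_iff, h0, Germ.coe_lt]

theorem Filter.Germ.exists_polynomial_eval_eq (p : (Germ (U : Filter Ω) ℝ)[X]) :
    ∃ P : Ω → ℝ[X], ∀ a : Ω → ℝ, p.eval (a : Germ (U : Filter Ω) ℝ) =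
      ((fun ω ↦ (P ω).eval (a ω) : Ω → ℝ) : Germ (U : Filter Ω) ℝ) := by
  induction p using Polynomial.induction_on' with
  | add p q hp hq =>
    obtain ⟨P, hP⟩ := hp
    obtain ⟨Q, hQ⟩ := hq
    refine ⟨P + Q, fun a ↦ ?_⟩
    simp only [Polynomial.eval_add, hP, hQ, Pi.add_apply]
    rfl
  | monomial n c =>
    induction c using Germ.inductionOn with | _ c
    refine ⟨fun ω ↦ Polynomial.monomial n (c ω), fun a ↦ ?_⟩
    simp only [Polynomial.eval_monomial]
    rfl

theorem Real.polynomialIVT : PolynomialIVT ℝ := by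
  intro p a b hab ha hb
  obtain ⟨c, hc, h⟩ := intermediate_value_Ioo hab.le p.continuous.continuousOn ⟨ha, hb⟩
  exact ⟨c, hc.1, hc.2, h⟩

theorem Filter.Germ.polynomialIVT : PolynomialIVT (Germ (U : Filter Ω) ℝ) := by
  intro p a b
  induction a using Germ.inductionOn with | _ a
  induction b using Germ.inductionOn with | _ b
  obtain ⟨P, hP⟩ := exists_polynomial_eval_eq p
  have h0 : (0 : Germ (U : Filter Ω) ℝ) = ((fun _ ↦ 0 : Ω → ℝ) : Germ (U : Filter Ω) ℝ) := rfl
  rw [hP, hP, h0, Germ.coe_lt, Germ.coe_lt, Germ.coe_lt]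
  intro hab ha hb
  have H : ∀ ω, ∃ c, a ω < b ω → (P ω).eval (a ω) < 0 → 0 < (P ω).eval (b ω) →
      a ω < c ∧ c < b ω ∧ (P ω).eval c = 0 := by
    intro ω
    by_cases h : a ω < b ω ∧ (P ω).eval (a ω) < 0 ∧ 0 < (P ω).eval (b ω)
    · obtain ⟨c, hc⟩ := Real.polynomialIVT _ _ _ h.1 h.2.1 h.2.2
      exact ⟨c, fun _ _ _ ↦ hc⟩
    · exact ⟨0, fun h1 h2 h3 ↦ absurd ⟨h1, h2, h3⟩ h⟩
  choose c hc using H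
  have hall : ∀ᶠ ω in U, a ω < c ω ∧ c ω < b ω ∧ (P ω).eval (c ω) = 0 := by
    filter_upwards [hab, ha, hb] with ω h1 h2 h3 using hc ω h1 h2 h3
  refine ⟨c, Germ.coe_lt.2 (hall.mono fun _ h ↦ h.1),
    Germ.coe_lt.2 (hall.mono fun _ h ↦ h.2.1), ?_⟩
  rw [hP]
  exact Germ.coe_eq.2 (hall.mono fun _ h ↦ h.2.2)

end Germ

section Transfer

variable {K : Type*} [Field K] [LinearOrder K] [IsStrictOrderedRing K]

theorem RingHom.sign_real (φ : ℝ →+* K) (c : ℝ) : SignType.sign (φ c) = SignType.sign c := by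
  have hpos (c : ℝ) (hc : 0 < c) : 0 < φ c := by
    rw [← Real.sq_sqrt hc.le, map_pow]
    have : φ √c ≠ 0 := (map_ne_zero φ).2 (Real.sqrt_pos.2 hc).ne'
    positivity
  rcases lt_trichotomy c 0 with h | rfl | h
  · have := hpos (-c) (by linarith)
    rw [map_neg, neg_pos] at this
    rw [sign_neg h, sign_neg this]
  · rw [map_zero, sign_zero, sign_zero]
  · rw [sign_pos h, sign_pos (hpos c h)]

open Filter in
/-- Every finite sign condition on polynomials realized over an ordered field with the
intermediate value property for polynomials is realized at a real point. -/
theorem PolynomialIVT.exists_real_point (hK : PolynomialIVT K) {n : ℕ}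
    (φ : MvPolynomial (Fin n) ℝ →+* K) (G : Finset (MvPolynomial (Fin n) ℝ)) :
    ∃ b : Fin n → ℝ, ∀ g ∈ G, SignType.sign (MvPolynomial.eval b g) = SignType.sign (φ g) := by
  classical
  induction n with
  | zero =>
    refine ⟨0, fun g _ ↦ ?_⟩
    rw [MvPolynomial.eq_C_of_isEmpty g, MvPolynomial.eval_C]
    exact ((φ.comp MvPolynomial.C).sign_real _).symm
  | succ n ih =>
    let e := MvPolynomial.finSuccEquiv ℝ n
    let φ' : MvPolynomial (Fin n) ℝ →+* K :=
      (φ.comp e.symm.toRingEquiv.toRingHom).comp Polynomial.C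
    let y : K := φ (e.symm Polynomial.X)
    have hφ (g) : φ g = (e g).eval₂ φ' y := by
      have := Polynomial.hom_eval₂ (e g) Polynomial.C (φ.comp e.symm.toRingEquiv.toRingHom) Polynomial.X
      rw [Polynomial.eval₂_C_X] at this
      refine (Eq.trans ?_ this)
      simp
    let f (H : Finset (MvPolynomial (Fin n) ℝ)) : Filter (Fin n → ℝ) :=
      𝓟 {b | ∀ h ∈ H, SignType.sign (MvPolynomial.eval b h) = SignType.sign (φ' h)}
    have hf : (iInf f).NeBot := by
      refine iInf_neBot_of_directed' ?_ fun H ↦ principal_neBot_iff.2 (ih φ' H)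
      intro H H'
      refine ⟨H ∪ H', ?_, ?_⟩ <;>
      · refine principal_mono.2 fun b hb h hh ↦ hb h ?_
        simp [hh]
    let U := Ultrafilter.of (iInf f)
    let Φ : MvPolynomial (Fin n) ℝ →+* ((Fin n → ℝ) → ℝ) := RingHom.pi fun b ↦ MvPolynomial.eval b
    let ψ : MvPolynomial (Fin n) ℝ →+* Germ (U : Filter (Fin n → ℝ)) ℝ :=
      (Germ.coeRingHom (U : Filter (Fin n → ℝ))).comp Φ
    have hψ (c) : SignType.sign (φ' c) = SignType.sign (ψ c) := by
      symm
      refine Germ.sign_coe_eq_iff.2 ?_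
      have h1 : (U : Filter (Fin n → ℝ)) ≤ f {c} := (Ultrafilter.of_le _).trans (iInf_le _ _)
      filter_upwards [le_principal_iff.1 h1] with b hb
      exact hb c (Finset.mem_singleton_self c)
    obtain ⟨z, hz⟩ := exists_sign_eval₂_eq_of_commRing hK Germ.polynomialIVT hψ (G.image e) y
    induction z using Germ.inductionOn with | _ a
    have hev : ∀ᶠ ω in U, ∀ g ∈ G, SignType.sign (MvPolynomial.eval (Fin.cons (a ω) ω) g) =
        SignType.sign (φ g) := by
      rw [eventually_all_finset]
      intro g hg
      have h1 := hz _ (Finset.mem_image_of_mem e hg)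
      rw [← hφ] at h1
      have h2 := Polynomial.hom_eval₂ (e g) Φ (Germ.coeRingHom (U : Filter (Fin n → ℝ))) a
      have h3 := h1.trans (congrArg SignType.sign h2.symm)
      refine (Germ.sign_coe_eq_iff.1 h3.symm).mono fun ω hω ↦ ?_
      rw [← hω, MvPolynomial.eval_eq_eval_mv_eval', Polynomial.eval_map]
      exact congrArg _ (Polynomial.hom_eval₂ (e g) Φ (Pi.evalRingHom _ ω) a).symm
    obtain ⟨ω, hω⟩ := hev.exists
    exact ⟨_, hω⟩

end Transfer

end

theorem RingPreordering.exists_ringHom_polynomialIVT.{u} {A : Type u} [CommRing A]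
    (P : RingPreordering A) :
    ∃ (K : Type u) (_ : Field K) (_ : LinearOrder K) (_ : IsStrictOrderedRing K) (φ : A →+* K),
      PolynomialIVT K ∧ ∀ t ∈ P, 0 ≤ φ t := by
  obtain ⟨Q, hPQ, hQ⟩ := P.exists_le_isOrdering
  have hprime : Q.support.IsPrime := inferInstance
  let F := FractionRing (A ⧸ Q.support)
  let ι : A →+* F := (algebraMap (A ⧸ Q.support) F).comp (Ideal.Quotient.mk Q.support)
  have hι (a : A) : ι a = 0 ↔ a ∈ Q.support := by
    rw [← Ideal.Quotient.eq_zero_iff_mem]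
    exact map_eq_zero_iff _ (IsFractionRing.injective (A ⧸ Q.support) F)
  let T : RingPreordering F := .mk' {x | ∃ a ∈ Q, ∃ b, ι b ≠ 0 ∧ x * ι b ^ 2 = ι a}
    (by
      rintro x y ⟨a, ha, b, hb, hx⟩ ⟨c, hc, d, hd, hy⟩
      refine ⟨a * d ^ 2 + c * b ^ 2, add_mem (mul_mem ha (Q.pow_two_mem d))
        (mul_mem hc (Q.pow_two_mem b)), b * d, by simp [hb, hd], ?_⟩
      simp only [map_mul, map_add, map_pow]
      linear_combination ι d ^ 2 * hx + ι b ^ 2 * hy)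
    (by
      rintro x y ⟨a, ha, b, hb, hx⟩ ⟨c, hc, d, hd, hy⟩
      refine ⟨a * c, mul_mem ha hc, b * d, by simp [hb, hd], ?_⟩
      simp only [map_mul]
      linear_combination y * ι d ^ 2 * hx + ι a * hy)
    (by
      intro x
      obtain ⟨a, b, hb, rfl⟩ := IsFractionRing.div_surjective (A ⧸ Q.support) x
      obtain ⟨a, rfl⟩ := Ideal.Quotient.mk_surjective a
      obtain ⟨b, rfl⟩ := Ideal.Quotient.mk_surjective b
      have hb' : ι b ≠ 0 := by
        rw [Ne, hι, ← Ideal.Quotient.eq_zero_iff_mem]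
        exact nonZeroDivisors.ne_zero hb
      refine ⟨a ^ 2, Q.pow_two_mem a, b, hb', ?_⟩
      change ι a / ι b * (ι a / ι b) * ι b ^ 2 = ι (a ^ 2)
      rw [map_pow, ← sq, ← mul_pow, div_mul_cancel₀ _ hb'])
    (by
      rintro ⟨a, ha, b, hb, h⟩
      have h0 : a + b ^ 2 ∈ Q.support := by
        rw [← hι, map_add, map_pow]
        linear_combination -h
      refine hb ((hι b).2 (hprime.mem_of_pow_mem 2 (RingPreordering.mem_support.2
        ⟨Q.pow_two_mem b, ?_⟩)))
      have := add_mem (RingPreordering.mem_support.1 h0).2 ha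
      rwa [show -(a + b ^ 2) + a = -b ^ 2 by ring] at this)
  obtain ⟨K, i₁, i₂, i₃, φ, hK, hφ⟩ := exists_polynomialIVT_extension T
  exact ⟨K, i₁, i₂, i₃, φ.comp ι, hK, fun t ht ↦ hφ _ ⟨t, hPQ ht, 1, by simp, by simp⟩⟩

/-- The **Positivstellensatz** for polynomials positive on a basic closed semialgebraic set. -/
theorem MvPolynomial.exists_mul_eq_one_add {n : ℕ} {T : Subsemiring (MvPolynomial (Fin n) ℝ)}
    (hT : ∀ a, a ^ 2 ∈ T) {G : Finset (MvPolynomial (Fin n) ℝ)} (hG : ∀ g ∈ G, g ∈ T)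
    {p : MvPolynomial (Fin n) ℝ} (hp : ∀ x, (∀ g ∈ G, 0 ≤ eval x g) → 0 < eval x p) :
    ∃ s ∈ T, ∃ t ∈ T, p * s = 1 + t := by
  classical
  by_contra! h
  let P : RingPreordering (MvPolynomial (Fin n) ℝ) := .mk' {x | ∃ s ∈ T, ∃ t ∈ T, x = s - p * t}
    (by
      rintro _ _ ⟨s, hs, t, ht, rfl⟩ ⟨s', hs', t', ht', rfl⟩
      exact ⟨s + s', add_mem hs hs', t + t', add_mem ht ht', by ring⟩)
    (by
      rintro _ _ ⟨s, hs, t, ht, rfl⟩ ⟨s', hs', t', ht', rfl⟩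
      exact ⟨s * s' + p ^ 2 * (t * t'), add_mem (mul_mem hs hs') (mul_mem (hT p) (mul_mem ht ht')),
        t * s' + s * t', add_mem (mul_mem ht hs') (mul_mem hs ht'), by ring⟩)
    (fun x ↦ ⟨x ^ 2, hT x, 0, zero_mem T, by ring⟩)
    (by
      rintro ⟨s, hs, t, ht, hst⟩
      exact h t ht s hs (by linear_combination hst))
  have hTP {t} (ht : t ∈ T) : t ∈ P := ⟨t, ht, 0, zero_mem T, by ring⟩
  obtain ⟨K, _, _, _, φ, hK, hφ⟩ := P.exists_ringHom_polynomialIVT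
  obtain ⟨b, hb⟩ := hK.exists_real_point φ (insert (-p) G)
  have hnonneg : ∀ g ∈ insert (-p) G, g ∈ P → 0 ≤ eval b g := by
    intro g hg hgP
    rw [← sign_nonneg_iff, hb g hg, sign_nonneg_iff]
    exact hφ g hgP
  have h₁ := hp b fun g hg ↦ hnonneg g (Finset.mem_insert_of_mem hg) (hTP (hG g hg))
  have h₂ := hnonneg (-p) (Finset.mem_insert_self _ _) ⟨0, zero_mem T, 1, one_mem T, by ring⟩
  rw [map_neg] at h₂
  linarith

section Archimedean

variable {A : Type*} [CommRing A] [Algebra ℝ A] {T : Subsemiring A}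

theorem algebraMap_mem_of_sq_mem (hT : ∀ a, a ^ 2 ∈ T) {c : ℝ} (hc : 0 ≤ c) :
    algebraMap ℝ A c ∈ T := by
  rw [← Real.sq_sqrt hc, map_pow]
  exact hT _

/-- The subalgebra of elements bounded by a real constant with respect to a subsemiring
containing all squares. -/
def boundedSubalgebra (T : Subsemiring A) (hT : ∀ a, a ^ 2 ∈ T) : Subalgebra ℝ A where
  carrier := {a | ∃ N : ℝ, algebraMap ℝ A N + a ∈ T ∧ algebraMap ℝ A N - a ∈ T}
  mul_mem' := by
    rintro a b ⟨N, hN, hN'⟩ ⟨M, hM, hM'⟩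
    have h2 : algebraMap ℝ A (1 / 2) * 2 = 1 := by
      rw [← map_ofNat (algebraMap ℝ A) 2, ← map_mul]
      norm_num
    have hhalf : algebraMap ℝ A (1 / 2) ∈ T := algebraMap_mem_of_sq_mem hT (by norm_num)
    refine ⟨N * M, ?_, ?_⟩
    · convert mul_mem hhalf (add_mem (mul_mem hN hM) (mul_mem hN' hM')) using 1
      rw [map_mul]
      linear_combination -(algebraMap ℝ A N * algebraMap ℝ A M + a * b) * h2
    · convert mul_mem hhalf (add_mem (mul_mem hN hM') (mul_mem hN' hM)) using 1
      rw [map_mul]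
      linear_combination -(algebraMap ℝ A N * algebraMap ℝ A M - a * b) * h2
  add_mem' := by
    rintro a b ⟨N, hN, hN'⟩ ⟨M, hM, hM'⟩
    refine ⟨N + M, ?_, ?_⟩
    · convert add_mem hN hM using 1
      rw [map_add]
      ring
    · convert add_mem hN' hM' using 1
      rw [map_add]
      ring
  algebraMap_mem' c := by
    refine ⟨|c|, ?_, ?_⟩
    · rw [← map_add]
      exact algebraMap_mem_of_sq_mem hT (by linarith [neg_abs_le c])
    · rw [← map_sub]
      exact algebraMap_mem_of_sq_mem hT (by linarith [le_abs_self c])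

theorem mem_boundedSubalgebra_of_sq (hT : ∀ a, a ^ 2 ∈ T) {R : ℝ} {a : A}
    (ha : algebraMap ℝ A R - a ^ 2 ∈ T) : a ∈ boundedSubalgebra T hT := by
  have h2 : algebraMap ℝ A (1 / 2) * 2 = 1 := by
    rw [← map_ofNat (algebraMap ℝ A) 2, ← map_mul]
    norm_num
  refine ⟨R + (1 / 2) ^ 2, ?_, ?_⟩
  · convert add_mem ha (hT (a + algebraMap ℝ A (1 / 2))) using 1
    rw [map_add, map_pow]
    linear_combination -a * h2
  · convert add_mem ha (hT (a - algebraMap ℝ A (1 / 2))) using 1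
    rw [map_add, map_pow]
    linear_combination a * h2

/-- In an archimedean preordering, an element with a positivity certificate is a member. -/
theorem mem_of_mul_eq_one_add (hT : ∀ a, a ^ 2 ∈ T)
    (harch : ∀ a, ∃ N : ℝ, algebraMap ℝ A N - a ∈ T) {p s t : A} (hs : s ∈ T) (ht : t ∈ T)
    (h : p * s = 1 + t) : p ∈ T := by
  obtain ⟨N, hN⟩ : ∃ N : ℝ, 0 < N ∧ algebraMap ℝ A N - s ∈ T := by
    obtain ⟨N, hN⟩ := harch s
    refine ⟨|N| + 1, by positivity, ?_⟩
    convert add_mem hN (algebraMap_mem_of_sq_mem (A := A) hT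
      (c := |N| + 1 - N) (by linarith [le_abs_self N])) using 1
    rw [map_sub]
    ring
  have hstep (r : ℝ) (hr : 0 ≤ r) (hpr : p + algebraMap ℝ A r ∈ T) :
      p + algebraMap ℝ A (r - N⁻¹) ∈ T := by
    have hinv : algebraMap ℝ A N⁻¹ * algebraMap ℝ A N = 1 := by
      rw [← map_mul, inv_mul_cancel₀ hN.1.ne', map_one]
    convert mul_mem (algebraMap_mem_of_sq_mem (A := A) hT (inv_pos.2 hN.1).le)
      (add_mem (add_mem (mul_mem hN.2 hpr) ht)
        (mul_mem (algebraMap_mem_of_sq_mem hT hr) hs)) using 1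
    rw [map_sub]
    linear_combination -(p + algebraMap ℝ A r) * hinv + algebraMap ℝ A N⁻¹ * h
  have hneg (r : ℝ) (hr : r ≤ 0) (hpr : p + algebraMap ℝ A r ∈ T) : p ∈ T := by
    convert add_mem hpr (algebraMap_mem_of_sq_mem (A := A) hT (neg_nonneg.2 hr)) using 1
    rw [map_neg]
    ring
  have hiter (k : ℕ) : ∀ r : ℝ, r ≤ k * N⁻¹ → p + algebraMap ℝ A r ∈ T → p ∈ T := by
    induction k with
    | zero => exact fun r hr ↦ hneg r (by simpa using hr)
    | succ k ih =>
      intro r hr hpr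
      rcases le_total r 0 with h0 | h0
      · exact hneg r h0 hpr
      · refine ih (r - N⁻¹) ?_ (hstep r h0 hpr)
        push_cast at hr
        linarith
  obtain ⟨r, hr⟩ := harch (-p)
  obtain ⟨k, hk⟩ := exists_nat_ge (r * N)
  refine hiter k r ?_ (by rwa [sub_neg_eq_add, add_comm] at hr)
  rw [← div_eq_mul_inv, le_div_iff₀ hN.1]
  exact hk

/-- Wörmann's trick: a positivity certificate for `R - q` bounds `q`. -/
theorem exists_algebraMap_sub_mem (hT : ∀ a, a ^ 2 ∈ T) {q s t : A} {R : ℝ} (hR : 0 ≤ R)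
    (hq : q ∈ T) (hs : s ∈ T) (ht : t ∈ T) (h : (algebraMap ℝ A R - q) * s = 1 + t)
    (harch : ∀ T' : Subsemiring A, (∀ a, a ^ 2 ∈ T') → algebraMap ℝ A R - q ∈ T' →
      ∀ a, ∃ N : ℝ, algebraMap ℝ A N - a ∈ T') : ∃ N : ℝ, algebraMap ℝ A N - q ∈ T := by
  let g := algebraMap ℝ A R - q
  let T' : Subsemiring A := {
    carrier := {x | ∃ a ∈ T, ∃ b ∈ T, x = a + g * b}
    zero_mem' := ⟨0, zero_mem T, 0, zero_mem T, by ring⟩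
    one_mem' := ⟨1, one_mem T, 0, zero_mem T, by ring⟩
    add_mem' := by
      rintro _ _ ⟨a, ha, b, hb, rfl⟩ ⟨c, hc, d, hd, rfl⟩
      exact ⟨a + c, add_mem ha hc, b + d, add_mem hb hd, by ring⟩
    mul_mem' := by
      rintro _ _ ⟨a, ha, b, hb, rfl⟩ ⟨c, hc, d, hd, rfl⟩
      exact ⟨a * c + g ^ 2 * (b * d), add_mem (mul_mem ha hc) (mul_mem (hT g) (mul_mem hb hd)),
        a * d + b * c, add_mem (mul_mem ha hd) (mul_mem hb hc), by ring⟩ }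
  obtain ⟨m, a, ha, b, hb, hm⟩ := harch T' (fun a ↦ ⟨a ^ 2, hT a, 0, zero_mem T, by ring⟩)
    ⟨0, zero_mem T, 1, one_mem T, by ring⟩ t
  have h1 : 1 + t ∈ T := add_mem (one_mem T) ht
  have hNt : algebraMap ℝ A (m + (m / 2) ^ 2) - t ∈ T := by
    have h2 : algebraMap ℝ A (m / 2) * 2 = algebraMap ℝ A m := by
      rw [← map_ofNat (algebraMap ℝ A) 2, ← map_mul]
      norm_num
    convert add_mem (add_mem (mul_mem h1 ha) (mul_mem (mul_mem hs (hT g)) hb))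
      (hT (algebraMap ℝ A (m / 2) - t)) using 1
    rw [map_add, map_pow]
    linear_combination (1 + t) * hm + t * h2 - g * b * h
  refine ⟨R * (m + (m / 2) ^ 2) + R, ?_⟩
  have hgT : g * (1 + t) ∈ T := by
    rw [← h, show g * (g * s) = g ^ 2 * s by ring]
    exact mul_mem (hT g) hs
  convert add_mem (add_mem (mul_mem (algebraMap_mem_of_sq_mem hT hR) hNt) hgT)
    (mul_mem hq ht) using 1
  rw [map_add, map_mul]
  ring

end Archimedean

theorem MvPolynomial.exists_algebraMap_sub_mem {n : ℕ} {T : Subsemiring (MvPolynomial (Fin n) ℝ)}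
    (hT : ∀ a, a ^ 2 ∈ T) {R : ℝ} (hR : algebraMap ℝ _ R - ∑ i, X i ^ 2 ∈ T)
    (a : MvPolynomial (Fin n) ℝ) : ∃ N : ℝ, algebraMap ℝ _ N - a ∈ T := by
  have htop : boundedSubalgebra T hT = ⊤ := by
    rw [eq_top_iff, ← MvPolynomial.adjoin_range_X, Algebra.adjoin_le_iff]
    rintro _ ⟨i, rfl⟩
    refine mem_boundedSubalgebra_of_sq hT (R := R) ?_
    convert add_mem hR (sum_mem (t := Finset.univ.erase i) fun j _ ↦ hT (X j)) using 1
    rw [← Finset.add_sum_erase _ _ (Finset.mem_univ i)]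
    ring
  obtain ⟨N, -, hN⟩ : a ∈ boundedSubalgebra T hT := htop ▸ Algebra.mem_top
  exact ⟨N, hN⟩

theorem MvPolynomial.mem_of_pos_of_bounded {n : ℕ} {T : Subsemiring (MvPolynomial (Fin n) ℝ)}
    (hT : ∀ a, a ^ 2 ∈ T) {G : Finset (MvPolynomial (Fin n) ℝ)} (hG : ∀ g ∈ G, g ∈ T)
    (hbdd : Bornology.IsBounded {x : Fin n → ℝ | ∀ g ∈ G, 0 ≤ eval x g})
    {p : MvPolynomial (Fin n) ℝ} (hp : ∀ x, (∀ g ∈ G, 0 ≤ eval x g) → 0 < eval x p) : p ∈ T := by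
  obtain ⟨r, hr⟩ := hbdd.exists_norm_le
  let q : MvPolynomial (Fin n) ℝ := ∑ i, X i ^ 2
  have hq : ∀ x, (∀ g ∈ G, 0 ≤ eval x g) →
      0 < eval x (algebraMap ℝ _ (n * r ^ 2 + 1) - q) := by
    intro x hx
    have hle : ∑ i, x i ^ 2 ≤ ∑ _i : Fin n, r ^ 2 := Finset.sum_le_sum fun i _ ↦
      sq_le_sq' (by linarith [neg_abs_le (x i), norm_le_pi_norm x i, hr x hx,
        Real.norm_eq_abs (x i)]) ((le_abs_self _).trans ((norm_le_pi_norm x i).trans (hr x hx)))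
    simp only [Finset.sum_const, Finset.card_univ, Fintype.card_fin, nsmul_eq_mul] at hle
    simp only [q, MvPolynomial.algebraMap_eq, map_sub, eval_C, map_sum, map_pow, eval_X]
    linarith
  obtain ⟨s, hs, t, ht, hst⟩ := exists_mul_eq_one_add hT hG hq
  obtain ⟨N, hN⟩ := _root_.exists_algebraMap_sub_mem hT (by positivity)
    (sum_mem fun i _ ↦ hT (X i)) hs ht hst fun _ h h' ↦ exists_algebraMap_sub_mem h h'
  obtain ⟨s, hs, t, ht, hst⟩ := exists_mul_eq_one_add hT hG hp
  exact mem_of_mul_eq_one_add hT (exists_algebraMap_sub_mem hT hN) hs ht hst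

section SOS

variable {σ : Type*}

theorem IsSOS.zero : IsSOS (0 : MvPolynomial σ ℝ) := ⟨0, Fin.elim0, by simp⟩

theorem IsSOS.sq (a : MvPolynomial σ ℝ) : IsSOS (a ^ 2) := ⟨1, fun _ ↦ a, by simp⟩

theorem IsSOS.add {p q : MvPolynomial σ ℝ} (hp : IsSOS p) (hq : IsSOS q) : IsSOS (p + q) := by
  obtain ⟨m, f, rfl⟩ := hp
  obtain ⟨m', f', rfl⟩ := hq
  exact ⟨m + m', Fin.append f f', by simp [Fin.sum_univ_add]⟩

end SOS

section Preordering

variable {A : Type*} [CommRing A] {m : ℕ}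

/-- The products `a² ∏ᵢ fᵢ^{kᵢ}` with `k ∈ {0,1}^m`. -/
def squareMulProd (f : Fin m → A) : Submonoid A where
  carrier := {x | ∃ (a : A) (k : Fin m → Bool), x = a ^ 2 * ∏ i, f i ^ (if k i then 1 else 0)}
  one_mem' := ⟨1, fun _ ↦ false, by simp⟩
  mul_mem' := by
    rintro _ _ ⟨a, k, rfl⟩ ⟨b, l, rfl⟩
    refine ⟨a * b * ∏ i, f i ^ (if k i && l i then 1 else 0), fun i ↦ k i ^^ l i, ?_⟩
    have (i : Fin m) : f i ^ (if k i then 1 else 0) * f i ^ (if l i then 1 else 0) =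
        (f i ^ (if k i && l i then 1 else 0)) ^ 2 * f i ^ (if k i ^^ l i then 1 else 0) := by
      cases k i <;> cases l i <;> simp [sq]
    have hprod := Finset.prod_congr (s₁ := Finset.univ) rfl fun i _ ↦ this i
    rw [Finset.prod_mul_distrib, Finset.prod_mul_distrib, Finset.prod_pow] at hprod
    linear_combination a ^ 2 * b ^ 2 * hprod

/-- The preordering generated by the `fᵢ` and an ideal `I`. -/
def generatedPreordering (f : Fin m → A) (I : Ideal A) : Subsemiring A :=
  ((squareMulProd f).subsemiringClosure.map (Ideal.Quotient.mk I)).comap (Ideal.Quotient.mk I)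

variable {f : Fin m → A} {I : Ideal A}

theorem mem_generatedPreordering {a : A} :
    a ∈ generatedPreordering f I ↔
      ∃ s ∈ AddSubmonoid.closure (squareMulProd f : Set A), a - s ∈ I := by
  simp only [generatedPreordering, Subsemiring.mem_comap, Subsemiring.mem_map]
  refine exists_congr fun s ↦ and_congr Iff.rfl ?_
  rw [eq_comm, Ideal.Quotient.eq]

theorem squareMulProd_subset_generatedPreordering {a : A} (ha : a ∈ squareMulProd f) :
    a ∈ generatedPreordering f I :=
  mem_generatedPreordering.2 ⟨a, AddSubmonoid.subset_closure ha, by simp⟩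

theorem sq_mem_generatedPreordering (a : A) : a ^ 2 ∈ generatedPreordering f I :=
  squareMulProd_subset_generatedPreordering ⟨a, fun _ ↦ false, by simp⟩

theorem apply_mem_generatedPreordering (i : Fin m) : f i ∈ generatedPreordering f I := by
  refine squareMulProd_subset_generatedPreordering ⟨1, fun j ↦ decide (j = i), ?_⟩
  rw [Finset.prod_eq_single i (by simp +contextual) (by simp)]
  simp

theorem mem_generatedPreordering_of_mem {a : A} (ha : a ∈ I) : a ∈ generatedPreordering f I :=
  mem_generatedPreordering.2 ⟨0, zero_mem _, by simpa using ha⟩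

end Preordering

theorem exists_isSOS_of_mem_closure {σ : Type*} {m : ℕ} {f : Fin m → MvPolynomial σ ℝ}
    {p : MvPolynomial σ ℝ}
    (hp : p ∈ AddSubmonoid.closure (squareMulProd f : Set (MvPolynomial σ ℝ))) :
    ∃ s : (Fin m → Bool) → MvPolynomial σ ℝ, (∀ k, IsSOS (s k)) ∧
      p = ∑ k : Fin m → Bool, s k * ∏ i, f i ^ (if k i then 1 else 0) := by
  induction hp using AddSubmonoid.closure_induction with
  | mem x hx =>
    obtain ⟨a, k, rfl⟩ := hx
    refine ⟨Pi.single k (a ^ 2), fun l ↦ ?_, ?_⟩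
    · rcases eq_or_ne l k with rfl | h
      · simpa using IsSOS.sq a
      · simpa [h] using IsSOS.zero
    · rw [Finset.sum_eq_single k (by simp +contextual) (by simp), Pi.single_eq_same]
  | zero => exact ⟨0, fun _ ↦ IsSOS.zero, by simp⟩
  | add x y _ _ hx hy =>
    obtain ⟨s, hs, rfl⟩ := hx
    obtain ⟨t, ht, rfl⟩ := hy
    exact ⟨s + t, fun k ↦ (hs k).add (ht k), by simp [add_mul, Finset.sum_add_distrib]⟩

/-- **Schmüdgen's Corollary.** If the semialgebraic set
`S = {x : fᵢ(x) ≥ 0, hⱼ(x) = 0}` is compact and `p > 0` on `S`, then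
`p = Σ_{k ∈ {0,1}^{n₁}} s_k · Πᵢ fᵢ^{kᵢ} + Σⱼ qⱼ hⱼ` for some SOS polynomials `s_k`
and polynomials `qⱼ`. -/
theorem schmudgen_corollary {n n₁ n₃ : ℕ}
    (f : Fin n₁ → MvPolynomial (Fin n) ℝ) (h : Fin n₃ → MvPolynomial (Fin n) ℝ)
    (hS : IsCompact {x : Fin n → ℝ | (∀ i, 0 ≤ eval x (f i)) ∧ ∀ j, eval x (h j) = 0})
    (p : MvPolynomial (Fin n) ℝ)
    (hp : ∀ x ∈ {x : Fin n → ℝ | (∀ i, 0 ≤ eval x (f i)) ∧ ∀ j, eval x (h j) = 0},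
      0 < eval x p) :
    ∃ (s : (Fin n₁ → Bool) → MvPolynomial (Fin n) ℝ)
      (q : Fin n₃ → MvPolynomial (Fin n) ℝ),
      (∀ k, IsSOS (s k)) ∧
      p = (∑ k : Fin n₁ → Bool, s k * ∏ i, f i ^ (if k i then 1 else 0)) +
            ∑ j, q j * h j := by
  classical
  let I := Ideal.span (Set.range h)
  have hI (j) : h j ∈ I := Ideal.subset_span ⟨j, rfl⟩
  let G := Finset.univ.image f ∪ (Finset.univ.image h ∪ Finset.univ.image (-h))
  have hGS (x : Fin n → ℝ) (hx : ∀ g ∈ G, 0 ≤ eval x g) :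
      (∀ i, 0 ≤ eval x (f i)) ∧ ∀ j, eval x (h j) = 0 := by
    refine ⟨fun i ↦ hx _ (by simp [G]), fun j ↦ le_antisymm ?_ (hx _ (by simp [G]))⟩
    simpa using hx (-h j) (by simp [G])
  have hG : ∀ g ∈ G, g ∈ generatedPreordering f I := by
    intro g hg
    simp only [G, Finset.mem_union, Finset.mem_image, Finset.mem_univ, true_and] at hg
    rcases hg with ⟨i, rfl⟩ | ⟨j, rfl⟩ | ⟨j, rfl⟩
    · exact apply_mem_generatedPreordering i
    · exact mem_generatedPreordering_of_mem (hI j)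
    · exact mem_generatedPreordering_of_mem (neg_mem (hI j))
  have hmem := MvPolynomial.mem_of_pos_of_bounded sq_mem_generatedPreordering hG
    (hS.isBounded.subset hGS) fun x hx ↦ hp x (hGS x hx)
  obtain ⟨t, ht, hpt⟩ := mem_generatedPreordering.1 hmem
  obtain ⟨s, hs, rfl⟩ := exists_isSOS_of_mem_closure ht
  obtain ⟨q, hq⟩ := (Submodule.mem_span_range_iff_exists_fun _).1 hpt
  refine ⟨s, q, hs, ?_⟩
  simp only [smul_eq_mul] at hq
  rw [hq]
  ring
end

section
/- (Putinar representation) Let f₁,…,f_{n₁}, h₁,…,h_{n₃} ∈ ℝ[x₁,…,xₙ] and set S = {x ∈ ℝⁿ : fᵢ(x) ≥ 0 for i = 1,…,n₁ and hⱼ(x) = 0 for j = 1,…,n₃}. Suppose the associated quadratic module is Archimedean, i.e. there exist N ∈ ℝ, SOS polynomials σ₀, σ₁,…,σ_{n₁}, and polynomials ρ₁,…,ρ_{n₃} with N − (x₁² + … + xₙ²) = σ₀ + Σᵢ σᵢ fᵢ + Σⱼ ρⱼ hⱼ. If p ∈ ℝ[x₁,…,xₙ] satisfies p(x) > 0 for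 all x ∈ S, then there exist SOS polynomials s₀, s₁,…,s_{n₁} and polynomials q₁,…,q_{n₃} such that p = s₀ + Σᵢ sᵢ fᵢ + Σⱼ qⱼ hⱼ. -/
open MvPolynomial

/-- A subset of a commutative ring which contains the squares, is closed under addition, and
is closed under multiplication by squares. -/
structure IsQuadraticModule {A : Type*} [CommRing A] (M : Set A) : Prop where
  sq_mem : ∀ a, a ^ 2 ∈ M
  add_mem : ∀ {a b}, a ∈ M → b ∈ M → a + b ∈ M
  sq_mul_mem : ∀ a {b}, b ∈ M → a ^ 2 * b ∈ M

namespace IsQuadraticModule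

variable {A : Type*} [CommRing A] {M : Set A}

theorem zero_mem (hM : IsQuadraticModule M) : (0 : A) ∈ M := by
  simpa using hM.sq_mem 0

theorem sumSq_mul_mem (hM : IsQuadraticModule M) {s b : A} (hs : IsSumSq s) (hb : b ∈ M) :
    s * b ∈ M := by
  induction hs with
  | zero => simpa using hM.zero_mem
  | sq_add a _ ih =>
    rw [add_mul, ← sq]
    exact hM.add_mem (hM.sq_mul_mem a hb) ih

theorem sumSq_mem (hM : IsQuadraticModule M) {s : A} (hs : IsSumSq s) : s ∈ M := by
  simpa using hM.sumSq_mul_mem hs (by simpa using hM.sq_mem 1 : (1 : A) ∈ M)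

/-- The quadratic module generated by `M` and `a`. -/
theorem adjoin (hM : IsQuadraticModule M) (a : A) :
    IsQuadraticModule {x | ∃ m ∈ M, ∃ s, IsSumSq s ∧ x = m + s * a} where
  sq_mem b := ⟨b ^ 2, hM.sq_mem b, 0, .zero, by simp⟩
  add_mem := by
    rintro _ _ ⟨m, hm, s, hs, rfl⟩ ⟨m', hm', s', hs', rfl⟩
    exact ⟨m + m', hM.add_mem hm hm', s + s', hs.add hs', by ring⟩
  sq_mul_mem b := by
    rintro _ ⟨m, hm, s, hs, rfl⟩
    exact ⟨b ^ 2 * m, hM.sq_mul_mem b hm, b * b * s, (IsSumSq.mul_self b).mul hs, by ring⟩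

theorem subset_adjoin (M : Set A) (a : A) :
    M ⊆ {x | ∃ m ∈ M, ∃ s, IsSumSq s ∧ x = m + s * a} :=
  fun m hm => ⟨m, hm, 0, .zero, by simp⟩

theorem mem_adjoin (hM : IsQuadraticModule M) (a : A) :
    a ∈ {x | ∃ m ∈ M, ∃ s, IsSumSq s ∧ x = m + s * a} :=
  ⟨0, hM.zero_mem, 1, by simp, by simp⟩

/-- A proper quadratic module is contained in a maximal proper one. -/
theorem exists_le_maximal (hM : IsQuadraticModule M) (h1 : (-1 : A) ∉ M) :
    ∃ Q, M ⊆ Q ∧ Maximal (fun Q : Set A => IsQuadraticModule Q ∧ (-1 : A) ∉ Q) Q := by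
  refine zorn_subset_nonempty {Q : Set A | IsQuadraticModule Q ∧ (-1 : A) ∉ Q} ?_ M ⟨hM, h1⟩
  rintro c hc hchain ⟨Q₀, hQ₀⟩
  refine ⟨⋃₀ c, ⟨⟨fun a => ⟨Q₀, hQ₀, (hc hQ₀).1.sq_mem a⟩, ?_, ?_⟩, ?_⟩,
    fun s hs => Set.subset_sUnion_of_mem hs⟩
  · rintro a b ⟨Q, hQ, ha⟩ ⟨R, hR, hb⟩
    rcases hchain.total hQ hR with hle | hle
    · exact ⟨R, hR, (hc hR).1.add_mem (hle ha) hb⟩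
    · exact ⟨Q, hQ, (hc hQ).1.add_mem ha (hle hb)⟩
  · rintro a b ⟨Q, hQ, hb⟩
    exact ⟨Q, hQ, (hc hQ).1.sq_mul_mem a hb⟩
  · rintro ⟨Q, hQ, h⟩
    exact (hc hQ).2 h

variable [Algebra ℝ A]

theorem algebraMap_mul_mem (hM : IsQuadraticModule M) {r : ℝ} (hr : 0 ≤ r) {b : A} (hb : b ∈ M) :
    algebraMap ℝ A r * b ∈ M := by
  rw [← Real.sq_sqrt hr, map_pow]
  exact hM.sq_mul_mem _ hb

theorem algebraMap_mem (hM : IsQuadraticModule M) {r : ℝ} (hr : 0 ≤ r) : algebraMap ℝ A r ∈ M := by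
  rw [← Real.sq_sqrt hr, map_pow]
  exact hM.sq_mem _

theorem neg_one_mem_of_neg (hM : IsQuadraticModule M) {r : ℝ} (hr : r < 0)
    (h : algebraMap ℝ A r ∈ M) : (-1 : A) ∈ M := by
  have := hM.algebraMap_mul_mem (r := -r⁻¹) (by simpa using hr.le) h
  rwa [← map_mul, neg_mul, inv_mul_cancel₀ hr.ne, map_neg, map_one] at this

theorem mul_mem_of_mem_of_neg_mem (hM : IsQuadraticModule M) {a : A} (ha : a ∈ M) (ha' : -a ∈ M)
    (b : A) : b * a ∈ M := by
  have h2 : 2 * algebraMap ℝ A (1 / 2) = 1 := by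
    rw [← map_ofNat (algebraMap ℝ A) 2, ← map_mul]; norm_num
  have h := hM.add_mem (hM.sq_mul_mem (algebraMap ℝ A (1 / 2) * (b + 1)) ha)
    (hM.sq_mul_mem (algebraMap ℝ A (1 / 2) * (b - 1)) ha')
  convert h using 1
  linear_combination (-(b * a) * (1 + 2 * algebraMap ℝ A (1 / 2))) * h2

/-- A maximal proper quadratic module `Q` satisfies `Q ∪ -Q = A`. -/
theorem mem_or_neg_mem_of_maximal {Q : Set A}
    (hQ : Maximal (fun Q : Set A => IsQuadraticModule Q ∧ (-1 : A) ∉ Q) Q) (a : A) :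
    a ∈ Q ∨ -a ∈ Q := by
  have key : ∀ b, b ∉ Q → ∃ m ∈ Q, ∃ s, IsSumSq s ∧ -1 = m + s * b := by
    intro b hb
    by_contra hcon
    exact hb (hQ.2 ⟨hQ.1.1.adjoin b, hcon⟩ (subset_adjoin Q b) (hQ.1.1.mem_adjoin b))
  by_contra! hcon
  obtain ⟨m, hm, s, hs, e⟩ := key a hcon.1
  obtain ⟨m', hm', s', hs', e'⟩ := key (-a) hcon.2
  have hneg : -s ∈ Q := by
    convert hQ.1.1.add_mem (hQ.1.1.add_mem (hQ.1.1.sumSq_mul_mem hs' hm)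
      (hQ.1.1.sumSq_mul_mem hs hm')) (hQ.1.1.sumSq_mem hs') using 1
    linear_combination s' * e + s * e'
  apply hQ.1.2
  rw [e]
  refine hQ.1.1.add_mem hm ?_
  rw [mul_comm]
  exact hQ.1.1.mul_mem_of_mem_of_neg_mem (hQ.1.1.sumSq_mem hs) hneg a

theorem sq_sub_sq_mem (hM : IsQuadraticModule M) {r : ℝ} (hr : 0 < r) {a : A}
    (h₁ : algebraMap ℝ A r + a ∈ M) (h₂ : algebraMap ℝ A r - a ∈ M) :
    algebraMap ℝ A (r ^ 2) - a ^ 2 ∈ M := by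
  have hu : 2 * algebraMap ℝ A r * algebraMap ℝ A (1 / (2 * r)) = 1 := by
    rw [← map_ofNat (algebraMap ℝ A) 2, ← map_mul, ← map_mul, ← map_one (algebraMap ℝ A)]
    congr 1
    field_simp
  have h := hM.algebraMap_mul_mem (r := 1 / (2 * r)) (by positivity)
    (hM.add_mem (hM.sq_mul_mem (algebraMap ℝ A r - a) h₁)
      (hM.sq_mul_mem (algebraMap ℝ A r + a) h₂))
  convert h using 1
  rw [map_pow]
  linear_combination (-(algebraMap ℝ A r ^ 2 - a ^ 2)) * hu

/-- The elements which are infinitesimal with respect to `M`. -/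
def infinitesimals (M : Set A) : Set A :=
  {a | ∀ ε : ℝ, 0 < ε → algebraMap ℝ A ε + a ∈ M ∧ algebraMap ℝ A ε - a ∈ M}

theorem infinitesimals_add (hM : IsQuadraticModule M) {a b : A} (ha : a ∈ infinitesimals M)
    (hb : b ∈ infinitesimals M) : a + b ∈ infinitesimals M := by
  intro ε hε
  have e : algebraMap ℝ A ε = algebraMap ℝ A (ε / 2) + algebraMap ℝ A (ε / 2) := by
    rw [← map_add, add_halves]
  obtain ⟨h₁, h₂⟩ := ha (ε / 2) (half_pos hε)
  obtain ⟨h₃, h₄⟩ := hb (ε / 2) (half_pos hε)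
  rw [e]
  constructor
  · convert hM.add_mem h₁ h₃ using 1; ring
  · convert hM.add_mem h₂ h₄ using 1; ring

theorem infinitesimals_neg {a : A} (ha : a ∈ infinitesimals M) : -a ∈ infinitesimals M := by
  intro ε hε
  obtain ⟨h₁, h₂⟩ := ha ε hε
  exact ⟨by simpa [sub_eq_add_neg] using h₂, by simpa using h₁⟩

theorem infinitesimals_sq (hM : IsQuadraticModule M) {a : A} (ha : a ∈ infinitesimals M) :
    a ^ 2 ∈ infinitesimals M := by
  intro ε hε
  refine ⟨hM.add_mem (hM.algebraMap_mem hε.le) (hM.sq_mem a), ?_⟩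
  have hs := Real.sqrt_pos.2 hε
  obtain ⟨h₁, h₂⟩ := ha _ hs
  simpa [Real.sq_sqrt hε.le] using hM.sq_sub_sq_mem hs h₁ h₂

theorem infinitesimals_algebraMap_mul (hM : IsQuadraticModule M) (r : ℝ) {a : A}
    (ha : a ∈ infinitesimals M) : algebraMap ℝ A r * a ∈ infinitesimals M := by
  have key : ∀ r : ℝ, 0 < r → algebraMap ℝ A r * a ∈ infinitesimals M := by
    intro r hr ε hε
    obtain ⟨h₁, h₂⟩ := ha (ε / r) (div_pos hε hr)
    have e : algebraMap ℝ A ε = algebraMap ℝ A r * algebraMap ℝ A (ε / r) := by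
      rw [← map_mul, mul_div_cancel₀ _ hr.ne']
    rw [e, ← mul_add, ← mul_sub]
    exact ⟨hM.algebraMap_mul_mem hr.le h₁, hM.algebraMap_mul_mem hr.le h₂⟩
  rcases lt_trichotomy r 0 with hr | rfl | hr
  · simpa using infinitesimals_neg (key (-r) (neg_pos.2 hr))
  · intro ε hε
    simpa using hM.algebraMap_mem hε.le
  · exact key r hr

theorem eq_zero_of_algebraMap_mem_infinitesimals (hM : IsQuadraticModule M) (h1 : (-1 : A) ∉ M)
    {r : ℝ} (hr : algebraMap ℝ A r ∈ infinitesimals M) : r = 0 := by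
  by_contra hne
  obtain ⟨h₁, h₂⟩ := hr (|r| / 2) (by positivity)
  rw [← map_add] at h₁
  rw [← map_sub] at h₂
  rcases lt_or_gt_of_ne hne with hr | hr
  · rw [abs_of_neg hr] at h₁
    exact h1 (hM.neg_one_mem_of_neg (by linarith) h₁)
  · rw [abs_of_pos hr] at h₂
    exact h1 (hM.neg_one_mem_of_neg (by linarith) h₂)

/-- Every element is infinitesimally close to a real number if `M` is Archimedean and
`M ∪ -M = A`. -/
theorem exists_sub_mem_infinitesimals (hM : IsQuadraticModule M) (h1 : (-1 : A) ∉ M)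
    (harch : ∀ a : A, ∃ N : ℝ, algebraMap ℝ A N - a ∈ M) (htot : ∀ a : A, a ∈ M ∨ -a ∈ M) (a : A) :
    ∃ r : ℝ, a - algebraMap ℝ A r ∈ infinitesimals M := by
  set S : Set ℝ := {r | a - algebraMap ℝ A r ∈ M} with hS
  have hne : S.Nonempty := by
    obtain ⟨N, hN⟩ := harch (-a)
    exact ⟨-N, by simpa [hS, add_comm] using hN⟩
  have hbdd : BddAbove S := by
    obtain ⟨N, hN⟩ := harch a
    refine ⟨N, fun r hr => ?_⟩
    by_contra! hlt
    refine h1 (hM.neg_one_mem_of_neg (sub_neg.2 hlt) ?_)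
    convert hM.add_mem hN hr using 1
    rw [map_sub]; ring
  refine ⟨sSup S, fun ε hε => ⟨?_, ?_⟩⟩
  · obtain ⟨r, hr, hlt⟩ := exists_lt_of_lt_csSup hne (sub_lt_self (sSup S) hε)
    convert hM.add_mem hr (hM.algebraMap_mem (r := r - (sSup S - ε)) (by linarith)) using 1
    simp only [map_sub]; ring
  · have hnot : sSup S + ε ∉ S := fun hmem => by
      have := le_csSup hbdd hmem
      linarith
    convert (htot (a - algebraMap ℝ A (sSup S + ε))).resolve_left hnot using 1
    rw [map_add]; ring

/-- A proper Archimedean quadratic module is nonnegative under some real character. -/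
theorem exists_algHom_nonneg (hM : IsQuadraticModule M) (h1 : (-1 : A) ∉ M)
    (harch : ∀ a : A, ∃ N : ℝ, algebraMap ℝ A N - a ∈ M) :
    ∃ φ : A →ₐ[ℝ] ℝ, ∀ m ∈ M, 0 ≤ φ m := by
  obtain ⟨Q, hMQ, hmax⟩ := hM.exists_le_maximal h1
  have hQ := hmax.1.1
  have hQ1 := hmax.1.2
  choose φ hφ using hQ.exists_sub_mem_infinitesimals hQ1
    (fun a => (harch a).imp fun _ h => hMQ h) (mem_or_neg_mem_of_maximal hmax)
  have huniq : ∀ (a : A) (r : ℝ), a - algebraMap ℝ A r ∈ infinitesimals Q → φ a = r := by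
    intro a r har
    refine sub_eq_zero.1 (hQ.eq_zero_of_algebraMap_mem_infinitesimals hQ1 ?_)
    convert hQ.infinitesimals_add har (infinitesimals_neg (hφ a)) using 1
    rw [map_sub]; ring
  have hadd : ∀ a b, φ (a + b) = φ a + φ b := fun a b => by
    refine huniq _ _ ?_
    convert hQ.infinitesimals_add (hφ a) (hφ b) using 1
    rw [map_add]; ring
  have hconst : ∀ r : ℝ, φ (algebraMap ℝ A r) = r := fun r => by
    refine huniq _ _ fun ε hε => ?_
    simpa using hQ.algebraMap_mem hε.le
  have hsq : ∀ a, φ (a ^ 2) = φ a ^ 2 := fun a => by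
    refine huniq _ _ ?_
    convert hQ.infinitesimals_add (hQ.infinitesimals_sq (hφ a))
      (hQ.infinitesimals_algebraMap_mul (2 * φ a) (hφ a)) using 1
    simp only [map_mul, map_pow, map_ofNat]; ring
  have hmul : ∀ a b, φ (a * b) = φ a * φ b := fun a b => by
    have h := hsq (a + b)
    rw [show (a + b) ^ 2 = a ^ 2 + b ^ 2 + (a * b + a * b) by ring] at h
    simp only [hadd, hsq] at h
    linarith
  refine ⟨{ toFun := φ, map_one' := by simpa using hconst 1, map_mul' := hmul,
            map_zero' := by simpa using hconst 0, map_add' := hadd, commutes' := hconst }, ?_⟩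
  intro m hm
  change 0 ≤ φ m
  by_contra! hlt
  refine hQ1 (hQ.neg_one_mem_of_neg (r := φ m / 2) (by linarith) ?_)
  convert hQ.add_mem (hφ m (-(φ m / 2)) (by linarith)).2 (hMQ hm) using 1
  rw [show algebraMap ℝ A (φ m) = algebraMap ℝ A (φ m / 2) + algebraMap ℝ A (φ m / 2) by
    rw [← map_add, add_halves], map_neg]
  ring

theorem mem_of_sumSq_mul_sub_one_mem (hM : IsQuadraticModule M)
    (harch : ∀ a : A, ∃ N : ℝ, algebraMap ℝ A N - a ∈ M) {p s : A} (hs : IsSumSq s)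
    (h : s * p - 1 ∈ M) : p ∈ M := by
  have hmono : ∀ {a : A} {r t : ℝ}, r ≤ t → algebraMap ℝ A r - a ∈ M →
      algebraMap ℝ A t - a ∈ M := by
    intro a r t hrt har
    convert hM.add_mem har (hM.algebraMap_mem (sub_nonneg.2 hrt)) using 1
    rw [map_sub]; ring
  obtain ⟨N₁, hN₁⟩ := harch s
  obtain ⟨N₂, hN₂⟩ := harch (s ^ 2 * p)
  obtain ⟨N₃, hN₃⟩ := harch (-p)
  obtain ⟨k, hk⟩ : ∃ k : ℝ, 1 ≤ k ∧ N₁ ≤ 2 * k ∧ N₂ ≤ 2 * k - 1 :=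
    ⟨|N₁| + |N₂| + 1, by linarith [abs_nonneg N₁, abs_nonneg N₂],
      by linarith [le_abs_self N₁, abs_nonneg N₁, abs_nonneg N₂],
      by linarith [le_abs_self N₂, abs_nonneg N₁, abs_nonneg N₂]⟩
  obtain ⟨hk1, hkN₁, hkN₂⟩ := hk
  have hk0 : k ≠ 0 := by positivity
  have hstep : ∀ r : ℝ, 0 ≤ r → p + algebraMap ℝ A r ∈ M →
      p + algebraMap ℝ A (r - (k⁻¹) ^ 2) ∈ M := by
    intro r hr hpr
    have hks : s * (algebraMap ℝ A (2 * k) - s) ∈ M := hM.sumSq_mul_mem hs (hmono hkN₁ hN₁)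
    have hsum := hM.sq_mul_mem (algebraMap ℝ A k⁻¹)
      (hM.add_mem (hM.add_mem (hM.sq_mul_mem (algebraMap ℝ A k - s) hpr)
        (hM.algebraMap_mul_mem (r := 2 * k) (by positivity) h))
        (hM.add_mem (hM.algebraMap_mul_mem hr hks) (hmono hkN₂ hN₂)))
    have hu : algebraMap ℝ A k⁻¹ * algebraMap ℝ A k = 1 := by
      rw [← map_mul, inv_mul_cancel₀ hk0, map_one]
    convert hsum using 1
    simp only [map_sub, map_mul, map_pow, map_ofNat, map_one]
    linear_combination (-(p + algebraMap ℝ A r) *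
      (1 + algebraMap ℝ A k⁻¹ * algebraMap ℝ A k)) * hu
  have hdesc : ∀ n : ℕ, p + algebraMap ℝ A (n * (k⁻¹) ^ 2) ∈ M → p ∈ M := by
    intro n
    induction n with
    | zero => simp
    | succ n ih =>
      intro hn
      refine ih ?_
      convert hstep _ (by positivity) hn using 3
      push_cast; ring
  obtain ⟨n, hn⟩ := exists_nat_ge (N₃ * k ^ 2)
  refine hdesc n ?_
  rw [add_comm, ← sub_neg_eq_add]
  refine hmono ?_ hN₃
  rw [inv_pow, ← div_eq_mul_inv, le_div_iff₀ (by positivity)]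
  exact hn

/-- The representation theorem for Archimedean quadratic modules: an element which is positive
under every real character that is nonnegative on `M` belongs to `M`. -/
theorem mem_of_forall_algHom_pos (hM : IsQuadraticModule M)
    (harch : ∀ a : A, ∃ N : ℝ, algebraMap ℝ A N - a ∈ M) {p : A}
    (hp : ∀ φ : A →ₐ[ℝ] ℝ, (∀ m ∈ M, 0 ≤ φ m) → 0 < φ p) : p ∈ M := by
  by_cases h1 : (-1 : A) ∈ {x | ∃ m ∈ M, ∃ s, IsSumSq s ∧ x = m + s * -p}
  · obtain ⟨m, hm, s, hs, e⟩ := h1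
    refine hM.mem_of_sumSq_mul_sub_one_mem harch hs ?_
    convert hm using 1
    linear_combination e
  · obtain ⟨φ, hφ⟩ := (hM.adjoin (-p)).exists_algHom_nonneg h1
      fun a => (harch a).imp fun _ h => subset_adjoin M (-p) h
    have hpos := hp φ fun m hm => hφ m (subset_adjoin M (-p) hm)
    have hneg := hφ _ (hM.mem_adjoin (-p))
    rw [map_neg] at hneg
    linarith

theorem bounded_of_sub_sq_mem (hM : IsQuadraticModule M) {a : A} {N : ℝ}
    (h : algebraMap ℝ A N - a ^ 2 ∈ M) :
    ∃ r : ℝ, 0 < r ∧ algebraMap ℝ A r + a ∈ M ∧ algebraMap ℝ A r - a ∈ M := by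
  have h2 : 2 * algebraMap ℝ A (1 / 2) = 1 := by
    rw [← map_ofNat (algebraMap ℝ A) 2, ← map_mul]; norm_num
  have hle := hM.algebraMap_mem (sub_nonneg.2 (le_abs_self N))
  refine ⟨|N| + (1 / 2) ^ 2, by positivity, ?_, ?_⟩
  · convert hM.add_mem (hM.add_mem h hle) (hM.sq_mem (a + algebraMap ℝ A (1 / 2))) using 1
    simp only [map_add, map_sub, map_pow]
    linear_combination -a * h2
  · convert hM.add_mem (hM.add_mem h hle) (hM.sq_mem (a - algebraMap ℝ A (1 / 2))) using 1
    simp only [map_add, map_sub, map_pow]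
    linear_combination a * h2

/-- The elements bounded with respect to a quadratic module form a subalgebra. -/
def boundedSubalgebra (hM : IsQuadraticModule M) : Subalgebra ℝ A :=
  have hadd : ∀ {a b : A},
      (∃ r : ℝ, 0 < r ∧ algebraMap ℝ A r + a ∈ M ∧ algebraMap ℝ A r - a ∈ M) →
      (∃ r : ℝ, 0 < r ∧ algebraMap ℝ A r + b ∈ M ∧ algebraMap ℝ A r - b ∈ M) →
      ∃ r : ℝ, 0 < r ∧ algebraMap ℝ A r + (a + b) ∈ M ∧ algebraMap ℝ A r - (a + b) ∈ M := by
    rintro a b ⟨r, hr, h₁, h₂⟩ ⟨t, ht, h₃, h₄⟩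
    refine ⟨r + t, add_pos hr ht, ?_, ?_⟩
    · convert hM.add_mem h₁ h₃ using 1; rw [map_add]; ring
    · convert hM.add_mem h₂ h₄ using 1; rw [map_add]; ring
  { carrier := {a | ∃ r : ℝ, 0 < r ∧ algebraMap ℝ A r + a ∈ M ∧ algebraMap ℝ A r - a ∈ M}
    add_mem' := hadd
    algebraMap_mem' := by
      intro t
      refine ⟨|t| + 1, by positivity, ?_, ?_⟩
      · rw [← map_add]
        exact hM.algebraMap_mem (by linarith [neg_abs_le t])
      · rw [← map_sub]
        exact hM.algebraMap_mem (by linarith [le_abs_self t])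
    mul_mem' := by
      rintro a b ha hb
      obtain ⟨r, hr, h₁, h₂⟩ := hadd ha hb
      obtain ⟨t, ht, h₃, h₄⟩ := hadd ha (b := -b) (by
        obtain ⟨t, ht, h₃, h₄⟩ := hb
        exact ⟨t, ht, by simpa [sub_eq_add_neg] using h₄, by simpa using h₃⟩)
      have h2 : 2 * algebraMap ℝ A (1 / 2) = 1 := by
        rw [← map_ofNat (algebraMap ℝ A) 2, ← map_mul]; norm_num
      refine ⟨((1 / 2) * r) ^ 2 + ((1 / 2) * t) ^ 2, by positivity, ?_, ?_⟩
      · convert hM.add_mem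
          (hM.add_mem (hM.algebraMap_mem (sq_nonneg ((1 / 2) * r)))
            (hM.sq_mem (algebraMap ℝ A (1 / 2) * (a + b))))
          (hM.sq_mul_mem (algebraMap ℝ A (1 / 2)) (hM.sq_sub_sq_mem ht h₃ h₄)) using 1
        simp only [map_add, map_mul, map_pow]
        linear_combination (-(a * b) * (1 + 2 * algebraMap ℝ A (1 / 2))) * h2
      · convert hM.add_mem
          (hM.add_mem (hM.algebraMap_mem (sq_nonneg ((1 / 2) * t)))
            (hM.sq_mem (algebraMap ℝ A (1 / 2) * (a + -b))))
          (hM.sq_mul_mem (algebraMap ℝ A (1 / 2)) (hM.sq_sub_sq_mem hr h₁ h₂)) using 1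
        simp only [map_add, map_mul, map_pow]
        linear_combination ((a * b) * (1 + 2 * algebraMap ℝ A (1 / 2))) * h2 }

end IsQuadraticModule

/-- A quadratic module in a polynomial ring is Archimedean as soon as it contains
`N - ∑ i, X i ^ 2` for some `N`. -/
theorem IsQuadraticModule.archimedean_of_sub_sum_sq_mem {ι : Type*} [Fintype ι]
    {M : Set (MvPolynomial ι ℝ)} (hM : IsQuadraticModule M) {N : ℝ}
    (hN : C N - ∑ i, X i ^ 2 ∈ M) (a : MvPolynomial ι ℝ) :
    ∃ r : ℝ, algebraMap ℝ (MvPolynomial ι ℝ) r - a ∈ M := by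
  classical
  have hX : ∀ i, X i ∈ hM.boundedSubalgebra := by
    intro i
    refine hM.bounded_of_sub_sq_mem (N := N) ?_
    have hsum : ∑ j ∈ Finset.univ.erase i, (X j : MvPolynomial ι ℝ) ^ 2 ∈ M :=
      Finset.sum_induction _ (· ∈ M) (fun _ _ => hM.add_mem) hM.zero_mem fun j _ => hM.sq_mem _
    convert hM.add_mem hN hsum using 1
    rw [← Finset.add_sum_erase _ _ (Finset.mem_univ i), algebraMap_eq]
    ring
  have htop : hM.boundedSubalgebra = ⊤ := by
    rw [eq_top_iff, ← adjoin_range_X, Algebra.adjoin_le_iff]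
    rintro _ ⟨i, rfl⟩
    exact hX i
  obtain ⟨r, -, -, hr⟩ : a ∈ hM.boundedSubalgebra := htop ▸ Algebra.mem_top
  exact ⟨r, hr⟩

theorem isSOS_iff_isSumSq {ι : Type*} {p : MvPolynomial ι ℝ} : IsSOS p ↔ IsSumSq p := by
  constructor
  · rintro ⟨m, f, rfl⟩
    exact .sum fun i _ => by rw [sq]; exact .mul_self _
  · intro hp
    induction hp with
    | zero => exact ⟨0, Fin.elim0, by simp⟩
    | sq_add a _ ih =>
      obtain ⟨m, f, rfl⟩ := ih
      exact ⟨m + 1, Fin.cons a f, by simp [Fin.sum_univ_succ, sq]⟩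

theorem isQuadraticModule_generated {A κ ν : Type*} [CommRing A] [Fintype κ] [Fintype ν]
    (f : κ → A) (h : ν → A) :
    IsQuadraticModule {p | ∃ (s₀ : A) (s : κ → A) (q : ν → A), IsSumSq s₀ ∧ (∀ i, IsSumSq (s i)) ∧
      p = s₀ + (∑ i, s i * f i) + ∑ j, q j * h j} where
  sq_mem a := ⟨a ^ 2, 0, 0, by rw [sq]; exact .mul_self a, fun _ => .zero, by simp⟩
  add_mem := by
    rintro _ _ ⟨s₀, s, q, hs₀, hs, rfl⟩ ⟨t₀, t, r, ht₀, ht, rfl⟩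
    refine ⟨s₀ + t₀, s + t, q + r, hs₀.add ht₀, fun i => (hs i).add (ht i), ?_⟩
    simp only [Pi.add_apply, add_mul, Finset.sum_add_distrib]
    ring
  sq_mul_mem a := by
    rintro _ ⟨s₀, s, q, hs₀, hs, rfl⟩
    refine ⟨a * a * s₀, fun i => a * a * s i, fun j => a * a * q j,
      (IsSumSq.mul_self a).mul hs₀, fun i => (IsSumSq.mul_self a).mul (hs i), ?_⟩
    simp only [mul_assoc, ← Finset.mul_sum]
    ring

/-- **Putinar representation.** Let `S = {x : fᵢ(x) ≥ 0, hⱼ(x) = 0}` and suppose the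
associated quadratic module is Archimedean: there are `N ∈ ℝ`, SOS polynomials
`σ₀, σ₁, …, σ_{n₁}` and polynomials `ρ₁, …, ρ_{n₃}` with
`N − (x₁² + … + xₙ²) = σ₀ + Σᵢ σᵢ fᵢ + Σⱼ ρⱼ hⱼ`. If `p > 0` on `S`, then
`p = s₀ + Σᵢ sᵢ fᵢ + Σⱼ qⱼ hⱼ` for some SOS polynomials `s₀, sᵢ` and polynomials `qⱼ`. -/
theorem putinar_representation {n n₁ n₃ : ℕ}
    (f : Fin n₁ → MvPolynomial (Fin n) ℝ) (h : Fin n₃ → MvPolynomial (Fin n) ℝ)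
    (harch : ∃ (N : ℝ) (σ₀ : MvPolynomial (Fin n) ℝ)
      (σ : Fin n₁ → MvPolynomial (Fin n) ℝ) (ρ : Fin n₃ → MvPolynomial (Fin n) ℝ),
      IsSOS σ₀ ∧ (∀ i, IsSOS (σ i)) ∧
      C N - ∑ i : Fin n, X i ^ 2 = σ₀ + (∑ i, σ i * f i) + ∑ j, ρ j * h j)
    (p : MvPolynomial (Fin n) ℝ)
    (hp : ∀ x ∈ {x : Fin n → ℝ | (∀ i, 0 ≤ eval x (f i)) ∧ ∀ j, eval x (h j) = 0},
      0 < eval x p) :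
    ∃ (s₀ : MvPolynomial (Fin n) ℝ) (s : Fin n₁ → MvPolynomial (Fin n) ℝ)
      (q : Fin n₃ → MvPolynomial (Fin n) ℝ),
      IsSOS s₀ ∧ (∀ i, IsSOS (s i)) ∧
      p = s₀ + (∑ i, s i * f i) + ∑ j, q j * h j := by
  simp only [isSOS_iff_isSumSq] at harch ⊢
  obtain ⟨N, hN⟩ := harch
  have hM := isQuadraticModule_generated f h
  refine hM.mem_of_forall_algHom_pos (hM.archimedean_of_sub_sum_sq_mem (N := N) hN) fun φ hφ => ?_
  have hφ_eval : ∀ a, φ a = eval (fun i => φ (X i)) a := fun a => by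
    rw [← coe_aeval_eq_eval]
    exact DFunLike.congr_fun (aeval_unique φ) a
  rw [hφ_eval]
  refine hp _ ⟨fun i => ?_, fun j => ?_⟩
  · rw [← hφ_eval]
    refine hφ _ ⟨0, Pi.single i 1, 0, .zero, fun k => ?_, by simp [Pi.single_apply]⟩
    by_cases hk : k = i
    · subst hk
      simp
    · simp [hk]
  · rw [← hφ_eval]
    have hpos := hφ (h j) ⟨0, 0, Pi.single j 1, .zero, fun _ => .zero, by simp [Pi.single_apply]⟩
    have hneg := hφ (-h j) ⟨0, 0, Pi.single j (-1), .zero, fun _ => .zero,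
      by simp [Pi.single_apply]⟩
    rw [map_neg] at hneg
    linarith
end

section
/- Let Q be a finite set and E ⊆ Q × Q. Let π₁,…,π_M ∈ ℝ[p₁,…,p_d] define the parameter set P = {p ∈ ℝ^d : π_m(p) ≥ 0 for all m}. For each q ∈ Q let g_{q,1},…,g_{q,K_q}, V_q ∈ ℝ[x₁,…,xₙ,p₁,…,p_d], let w_{q,1},…,w_{q,K'_q} ∈ ℝ[x], let f_q = (f_{q,1},…,f_{q,n}) with f_{q,i} ∈ ℝ[x,p], and let z_q ∈ ℝⁿ. For each e = (q,q') ∈ E let h_{e,0},…,h_{e,N_e} ∈ ℝ[x,p] and φ_e = (φ_{e,1},…,φ_{e,n}) with φ_{e,j} ∈ ℝ[x,p]. For p ∈ P define W_q(p) = {x ∈ ℝⁿ : g_{q,k}(x,p) ≥ 0 for all k and w_{q,k}(x) ≥ 0 for all k} and G_e(p) = {x ∈ ℝⁿ : h_{e,0}(x,p) = 0 and h_{e,l}(x,p) ≥ 0 for l = 1,…,N_e}. Suppose there exist constants α, γ > 0 and r_q ∈ (0,1], SOS polynomials in (x,p) a_{q,k}, b_{q,k}, c_{q,k}, d_{q,k},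 i_{q,k}, j_{q,k}, η_{q,m}, β_{q,m}, ζ_{q,m}, m_{e,l} (for l ≥ 1), and arbitrary polynomials m_{e,0} ∈ ℝ[x,p] such that, as polynomials: (i) for each q, V_q − α(x₁²+…+xₙ²) − Σ_k a_{q,k} w_{q,k} − Σ_k b_{q,k} g_{q,k} − Σ_m η_{q,m} π_m is SOS; (ii) for each q and each p, V_q(z_q,p) = 0; (iii) for each q, −Σᵢ (∂V_q/∂xᵢ)·f_{q,i} − γ − Σ_k c_{q,k} w_{q,k} − Σ_k d_{q,k} g_{q,k} − Σ_m β_{q,m} π_m is SOS; (iv) for each e = (q,q'), r_q V_q − V_{q'}(φ_e,p) − m_{e,0} h_{e,0} − Σ_{l=1}^{N_e} m_{e,l} h_{e,l} − Σ_k i_{q,k} w_{q,k} − Σ_k j_{q,k} g_{q,k} − Σ_m ζ_{q,m} π_m is SOS. Then for every p ∈ P and each q ∈ Q: V_q(x,p) ≥ α‖x‖² for all x ∈ W_q(p); V_q(z_q,p) = 0; Σᵢ (∂V_q/∂xᵢ)(x,p)·f_{q,i}(x,p) ≤ −γ for all x ∈ W_q(p); and for each e = (q,q') ∈ E, V_{q'}(φ_e(x,p),p)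 ≤ r_q V_q(x,p) for all x ∈ G_e(p) ∩ W_q(p). -/
open MvPolynomial

/-- Substitute the polynomials `φⱼ` for the `x`-variables of a polynomial in `(x,p)`,
leaving the `p`-variables unchanged. -/
noncomputable def substX {n d : ℕ} (φ : Fin n → MvPolynomial (Fin n ⊕ Fin d) ℝ)
    (q : MvPolynomial (Fin n ⊕ Fin d) ℝ) : MvPolynomial (Fin n ⊕ Fin d) ℝ :=
  aeval (Sum.elim φ (fun m => X (Sum.inr m))) q

theorem IsSOS.eval_nonneg {σ : Type*} {q : MvPolynomial σ ℝ} (hq : IsSOS q) (y : σ → ℝ) :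
    0 ≤ eval y q := by
  obtain ⟨m, f, rfl⟩ := hq
  simp only [map_sum, map_pow]
  exact Finset.sum_nonneg fun i _ => sq_nonneg _

theorem eval_sum_mul_nonneg {σ ι : Type*} [Fintype ι] {s t : ι → MvPolynomial σ ℝ} {y : σ → ℝ}
    (hs : ∀ k, IsSOS (s k)) (ht : ∀ k, 0 ≤ eval y (t k)) :
    0 ≤ eval y (∑ k, s k * t k) := by
  simp only [map_sum, map_mul]
  exact Finset.sum_nonneg fun k _ => mul_nonneg ((hs k).eval_nonneg y) (ht k)

theorem eval_substX {n d : ℕ} (φ : Fin n → MvPolynomial (Fin n ⊕ Fin d) ℝ)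
    (q : MvPolynomial (Fin n ⊕ Fin d) ℝ) (x : Fin n → ℝ) (p : Fin d → ℝ) :
    eval (Sum.elim x p) (substX φ q) =
      eval (Sum.elim (fun i => eval (Sum.elim x p) (φ i)) p) q := by
  induction q using MvPolynomial.induction_on with
  | C a => simp [substX]
  | add q₁ q₂ h₁ h₂ => simpa [substX] using congrArg₂ (· + ·) h₁ h₂
  | mul_X q v h =>
    have hv : eval (Sum.elim x p) (substX φ (X v)) =
        eval (Sum.elim (fun i => eval (Sum.elim x p) (φ i)) p) (X v) := by
      cases v <;> simp [substX]
    simpa only [substX, map_mul] using congrArg₂ (· * ·) h hv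

/-- A solution of the SOS Feasibility Problem 2 yields parameterized functions `V_q`
satisfying, uniformly over all admissible parameters `p` in the semialgebraic uncertainty
set `P = {p : πₘ(p) ≥ 0}`, the Lyapunov conditions certifying Zeno stability of the
common Zeno equilibrium `{z_q}`: positivity `V_q(x,p) ≥ α‖x‖²` on `W_q(p)`, vanishing at
`z_q`, decrease `Σᵢ (∂V_q/∂xᵢ)·f_{q,i} ≤ −γ` on `W_q(p)`, and decrease
`V_{q'}(φ_e(x,p),p) ≤ r_q V_q(x,p)` on `G_e(p) ∩ W_q(p)` for each edge `e = (q,q')`. -/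
theorem feasibility_problem_two_implies_robust_lyapunov
    {n d : ℕ} {Q : Type*} [Fintype Q] (E : Set (Q × Q))
    {M : ℕ} (π : Fin M → MvPolynomial (Fin d) ℝ)
    (P : Set (Fin d → ℝ)) (hP : P = {p | ∀ m, 0 ≤ eval p (π m)})
    (Kg Kw : Q → ℕ)
    (g : (q : Q) → Fin (Kg q) → MvPolynomial (Fin n ⊕ Fin d) ℝ)
    (w : (q : Q) → Fin (Kw q) → MvPolynomial (Fin n) ℝ)
    (V : Q → MvPolynomial (Fin n ⊕ Fin d) ℝ)
    (f : Q → Fin n → MvPolynomial (Fin n ⊕ Fin d) ℝ)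
    (z : Q → Fin n → ℝ)
    (Ne : Q × Q → ℕ)
    (h₀ : Q × Q → MvPolynomial (Fin n ⊕ Fin d) ℝ)
    (h : (e : Q × Q) → Fin (Ne e) → MvPolynomial (Fin n ⊕ Fin d) ℝ)
    (φ : Q × Q → Fin n → MvPolynomial (Fin n ⊕ Fin d) ℝ)
    -- the parameterized neighborhoods and guard sets
    (W : Q → (Fin d → ℝ) → Set (Fin n → ℝ))
    (hW : ∀ q p, W q p = {x | (∀ k, 0 ≤ eval (Sum.elim x p) (g q k)) ∧
      ∀ k, 0 ≤ eval x (w q k)})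
    (G : Q × Q → (Fin d → ℝ) → Set (Fin n → ℝ))
    (hG : ∀ e p, G e p = {x | eval (Sum.elim x p) (h₀ e) = 0 ∧
      ∀ l, 0 ≤ eval (Sum.elim x p) (h e l)})
    -- constants
    (α γ : ℝ) (hα : 0 < α) (hγ : 0 < γ)
    (r : Q → ℝ) (hr : ∀ q, 0 < r q ∧ r q ≤ 1)
    -- SOS multipliers
    (a : (q : Q) → Fin (Kw q) → MvPolynomial (Fin n ⊕ Fin d) ℝ)
    (b : (q : Q) → Fin (Kg q) → MvPolynomial (Fin n ⊕ Fin d) ℝ)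
    (c : (q : Q) → Fin (Kw q) → MvPolynomial (Fin n ⊕ Fin d) ℝ)
    (d' : (q : Q) → Fin (Kg q) → MvPolynomial (Fin n ⊕ Fin d) ℝ)
    (i : (q : Q) → Fin (Kw q) → MvPolynomial (Fin n ⊕ Fin d) ℝ)
    (j : (q : Q) → Fin (Kg q) → MvPolynomial (Fin n ⊕ Fin d) ℝ)
    (η β ζ : Q → Fin M → MvPolynomial (Fin n ⊕ Fin d) ℝ)
    (m₀ : Q × Q → MvPolynomial (Fin n ⊕ Fin d) ℝ)
    (m : (e : Q × Q) → Fin (Ne e) → MvPolynomial (Fin n ⊕ Fin d) ℝ)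
    (ha : ∀ q k, IsSOS (a q k)) (hb : ∀ q k, IsSOS (b q k))
    (hc : ∀ q k, IsSOS (c q k)) (hd : ∀ q k, IsSOS (d' q k))
    (hi : ∀ q k, IsSOS (i q k)) (hj : ∀ q k, IsSOS (j q k))
    (hη : ∀ q m', IsSOS (η q m')) (hβ : ∀ q m', IsSOS (β q m'))
    (hζ : ∀ q m', IsSOS (ζ q m'))
    (hm : ∀ e l, IsSOS (m e l))
    -- (i) positivity certificates
    (cert₁ : ∀ q, IsSOS (V q - C α * (∑ i' : Fin n, X (Sum.inl i') ^ 2)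
      - (∑ k, a q k * rename Sum.inl (w q k)) - (∑ k, b q k * g q k)
      - ∑ m', η q m' * rename Sum.inr (π m')))
    -- (ii) vanishing at the common Zeno equilibrium
    (cert₂ : ∀ q, ∀ p : Fin d → ℝ, eval (Sum.elim (z q) p) (V q) = 0)
    -- (iii) decrease certificates
    (cert₃ : ∀ q, IsSOS (-(∑ i' : Fin n, pderiv (Sum.inl i') (V q) * f q i') - C γ
      - (∑ k, c q k * rename Sum.inl (w q k)) - (∑ k, d' q k * g q k)
      - ∑ m', β q m' * rename Sum.inr (π m')))
    -- (iv) guard decrease certificates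
    (cert₄ : ∀ e ∈ E, IsSOS (C (r e.1) * V e.1 - substX (φ e) (V e.2)
      - m₀ e * h₀ e - (∑ l, m e l * h e l)
      - (∑ k, i e.1 k * rename Sum.inl (w e.1 k))
      - (∑ k, j e.1 k * g e.1 k)
      - ∑ m', ζ e.1 m' * rename Sum.inr (π m'))) :
    ∀ p ∈ P, ∀ q : Q,
      (∀ x ∈ W q p, α * (∑ i' : Fin n, x i' ^ 2) ≤ eval (Sum.elim x p) (V q)) ∧
      eval (Sum.elim (z q) p) (V q) = 0 ∧
      (∀ x ∈ W q p, (∑ i' : Fin n, eval (Sum.elim x p) (pderiv (Sum.inl i') (V q)) *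
        eval (Sum.elim x p) (f q i')) ≤ -γ) ∧
      (∀ e ∈ E, e.1 = q →
        ∀ x ∈ G e p ∩ W q p,
          eval (Sum.elim (fun i' => eval (Sum.elim x p) (φ e i')) p) (V e.2) ≤
            r q * eval (Sum.elim x p) (V q)) := by
  subst hP
  intro p hp q
  have hπ (x : Fin n → ℝ) (m' : Fin M) :
      0 ≤ eval (Sum.elim x p) (rename Sum.inr (π m')) := by
    rw [eval_rename, Sum.elim_comp_inr]
    exact hp m'
  have hg (x : Fin n → ℝ) (hx : x ∈ W q p) (k : Fin (Kg q)) :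
      0 ≤ eval (Sum.elim x p) (g q k) := by
    rw [hW] at hx
    exact hx.1 k
  have hw (x : Fin n → ℝ) (hx : x ∈ W q p) (k : Fin (Kw q)) :
      0 ≤ eval (Sum.elim x p) (rename Sum.inl (w q k)) := by
    rw [hW] at hx
    rw [eval_rename, Sum.elim_comp_inl]
    exact hx.2 k
  refine ⟨fun x hx => ?_, cert₂ q p, fun x hx => ?_, ?_⟩
  · have key := (cert₁ q).eval_nonneg (Sum.elim x p)
    have hA := eval_sum_mul_nonneg (ha q) (hw x hx)
    have hB := eval_sum_mul_nonneg (hb q) (hg x hx)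
    have hN := eval_sum_mul_nonneg (hη q) (hπ x)
    have hsq : eval (Sum.elim x p) (∑ i' : Fin n, X (Sum.inl i') ^ 2) = ∑ i', x i' ^ 2 := by
      simp
    rw [eval_sub, eval_sub, eval_sub, eval_sub, eval_mul, eval_C, hsq] at key
    linarith
  · have key := (cert₃ q).eval_nonneg (Sum.elim x p)
    have hA := eval_sum_mul_nonneg (hc q) (hw x hx)
    have hB := eval_sum_mul_nonneg (hd q) (hg x hx)
    have hN := eval_sum_mul_nonneg (hβ q) (hπ x)
    simp only [← eval_mul, ← eval_sum]
    rw [eval_sub, eval_sub, eval_sub, eval_sub, eval_neg, eval_C] at key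
    linarith
  · rintro e he rfl x ⟨hxG, hx⟩
    rw [hG] at hxG
    have key := (cert₄ e he).eval_nonneg (Sum.elim x p)
    have hH := eval_sum_mul_nonneg (hm e) hxG.2
    have hA := eval_sum_mul_nonneg (hi e.1) (hw x hx)
    have hB := eval_sum_mul_nonneg (hj e.1) (hg x hx)
    have hN := eval_sum_mul_nonneg (hζ e.1) (hπ x)
    rw [eval_sub, eval_sub, eval_sub, eval_sub, eval_sub, eval_sub, eval_mul, eval_C,
      eval_mul, hxG.1, mul_zero, eval_substX] at key
    linarith
end
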